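/- Let X be a compact Ptolemy space with properties (E) and (I), and let ω ∈ X. For every fiber F ⊆ X_ω of the canonical fibration π_ω and every point x ∈ X_ω∖F, there exists exactly one Ptolemy line in X_ω that contains x and intersects F. -/

import Mathlib

open scoped ENNReal

namespace Mobius

/-- An extended metric on `X`, allowed to have (at most) one infinitely remote point,
which is recorded in the field `rem`.  Distances take values in `ℝ≥0∞`, and the value `⊤`
occurs exactly on pairs of distinct points one of which is the remote point. -/
structure ExtMetric (X : Type*) where
  d : X → X → ℝ≥0∞
  rem : Option X
  symm : ∀ x y, d x y = d y x
  d_self : ∀ x, d x x = 0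
  pos : ∀ x y, x ≠ y → 0 < d x y
  triangle : ∀ x y z, d x z ≤ d x y + d y z
  d_eq_top_iff : ∀ x y, d x y = ⊤ ↔ (x ≠ y ∧ (rem = some x ∨ rem = some y))

/-- The finite factor of a distance used in cross-ratio triples: infinite factors are
dropped (replaced by `1`), in accordance with the standard conventions for cross-ratio
triples of quadruples containing the infinitely remote point. -/
noncomputable def ExtMetric.fd {X : Type*} (d : ExtMetric X) (x y : X) : ℝ :=
  if d.d x y = ⊤ then 1 else (d.d x y).toReal

/-- A representative in `ℝ³` of the cross-ratio triple
`crt(x,y,z,u) = (d(x,y)d(z,u) : d(x,z)d(y,u) : d(x,u)d(y,z)) ∈ ℝP²`,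
with the standard conventions when the infinitely remote point occurs among the points. -/
noncomputable def crtVec {X : Type*} (d : ExtMetric X) (x y z u : X) : ℝ × ℝ × ℝ :=
  (d.fd x y * d.fd z u, d.fd x z * d.fd y u, d.fd x u * d.fd y z)

/-- A quadruple is admissible if no entry occurs three or four times in it. -/
def Admissible {X : Type*} (x y z u : X) : Prop :=
  ¬(x = y ∧ y = z) ∧ ¬(x = y ∧ y = u) ∧ ¬(x = z ∧ z = u) ∧ ¬(y = z ∧ z = u)

/-- Two vectors in `ℝ³` represent the same point of the projective plane (they are
positively proportional). -/
def ProjEq (v w : ℝ × ℝ × ℝ) : Prop :=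
  ∃ lam : ℝ, 0 < lam ∧ w = lam • v

theorem ProjEq.refl (v : ℝ × ℝ × ℝ) : ProjEq v v :=
  ⟨1, one_pos, (one_smul ℝ v).symm⟩

theorem ProjEq.symm {v w : ℝ × ℝ × ℝ} (h : ProjEq v w) : ProjEq w v := by
  obtain ⟨l, hl, rfl⟩ := h
  exact ⟨l⁻¹, inv_pos.mpr hl, by rw [smul_smul, inv_mul_cancel₀ hl.ne', one_smul]⟩

theorem ProjEq.trans' {v w u : ℝ × ℝ × ℝ} (h1 : ProjEq v w) (h2 : ProjEq v u) :
    ProjEq w u := by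
  obtain ⟨l, hl, rfl⟩ := h1
  obtain ⟨m, hm, rfl⟩ := h2
  refine ⟨m * l⁻¹, by positivity, ?_⟩
  rw [smul_smul, mul_assoc, inv_mul_cancel₀ hl.ne', mul_one]

/-- A Möbius structure on a set `X`: a (maximal) class of pairwise Möbius-equivalent
extended metrics on `X`, i.e. metrics defining the same cross-ratio triples on all
admissible quadruples. -/
structure MobiusStructure (X : Type*) where
  M : Set (ExtMetric X)
  nonempty : M.Nonempty
  compat : ∀ d ∈ M, ∀ d' ∈ M, ∀ x y z u : X, Admissible x y z u →
    ProjEq (crtVec d x y z u) (crtVec d' x y z u)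
  maximal : ∀ d' : ExtMetric X,
    (∀ d ∈ M, ∀ x y z u : X, Admissible x y z u →
      ProjEq (crtVec d x y z u) (crtVec d' x y z u)) → d' ∈ M

/-- The Möbius structure generated by a single extended metric. -/
def MobiusStructure.ofMetric {X : Type*} (d₀ : ExtMetric X) : MobiusStructure X where
  M := {d | ∀ x y z u : X, Admissible x y z u →
    ProjEq (crtVec d₀ x y z u) (crtVec d x y z u)}
  nonempty := ⟨d₀, fun _ _ _ _ _ => ProjEq.refl _⟩
  compat := fun _ hd _ hd' x y z u ha => (hd x y z u ha).trans' (hd' x y z u ha)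
  maximal := fun _ h => h d₀ (fun _ _ _ _ _ => ProjEq.refl _)

/-- A Möbius structure is Ptolemy if the entries of every cross-ratio triple of every
admissible quadruple satisfy the triangle inequality. -/
def IsPtolemyStructure {X : Type*} (S : MobiusStructure X) : Prop :=
  ∀ d ∈ S.M, ∀ x y z u : X, Admissible x y z u →
    (crtVec d x y z u).1 ≤ (crtVec d x y z u).2.1 + (crtVec d x y z u).2.2 ∧
    (crtVec d x y z u).2.1 ≤ (crtVec d x y z u).1 + (crtVec d x y z u).2.2 ∧
    (crtVec d x y z u).2.2 ≤ (crtVec d x y z u).1 + (crtVec d x y z u).2.1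

/-- The topology of a Möbius space: generated by the open balls of the metrics of the
structure (centered at points distinct from the respective remote points) together with
the complements of the closed balls. -/
def mobiusTop {X : Type*} (S : MobiusStructure X) : TopologicalSpace X :=
  TopologicalSpace.generateFrom
    {s | ∃ d ∈ S.M, ∃ x : X, d.rem ≠ some x ∧ ∃ r : ℝ≥0∞, 0 < r ∧ r ≠ ⊤ ∧
      (s = {y | d.d y x < r} ∨ s = {y | r < d.d y x})}

/-- Connected components of subsets with respect to the Möbius topology. -/
def mobiusCCIn {X : Type*} (S : MobiusStructure X) (F : Set X) (x : X) : Set X :=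
  @connectedComponentIn X (mobiusTop S) F x

/-- The pair `(x,z)` separates the pair `(y,u)` in `σ`:  `y` and `u` lie in different
connected components of `σ \ {x,z}`. -/
def SeparatesIn {X : Type*} (S : MobiusStructure X) (σ : Set X) (x z y u : X) : Prop :=
  u ∉ mobiusCCIn S (σ \ {x, z}) y

/-- `σ` is homeomorphic to the circle `S¹` (with respect to the Möbius topology). -/
def HomeoToCircle {X : Type*} (S : MobiusStructure X) (σ : Set X) : Prop :=
  letI : TopologicalSpace X := mobiusTop S
  Nonempty (σ ≃ₜ Metric.sphere (0 : ℂ) 1)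

/-- `X` is homeomorphic to the sphere `Sⁿ ⊆ ℝ^{n+1}` (w.r.t. the Möbius topology). -/
def HomeoToSphere {X : Type*} (S : MobiusStructure X) (n : ℕ) : Prop :=
  letI : TopologicalSpace X := mobiusTop S
  Nonempty (X ≃ₜ Metric.sphere (0 : EuclideanSpace ℝ (Fin (n + 1))) 1)

/-- The subset `A ⊆ X` is homeomorphic to `ℝᵖ` (w.r.t. the Möbius topology). -/
def SubsetHomeoToEuclidean {X : Type*} (S : MobiusStructure X) (A : Set X) (p : ℕ) : Prop :=
  letI : TopologicalSpace X := mobiusTop S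
  Nonempty (A ≃ₜ EuclideanSpace ℝ (Fin p))

/-- The subset `A ⊆ X` is homeomorphic to `ℝ` (w.r.t. the Möbius topology). -/
def SubsetHomeoToReal {X : Type*} (S : MobiusStructure X) (A : Set X) : Prop :=
  letI : TopologicalSpace X := mobiusTop S
  Nonempty (A ≃ₜ ℝ)

/-- A Ptolemy circle: a subset homeomorphic to `S¹` on which the Ptolemy equality holds
for every quadruple of distinct points `(x,y,z,u)` such that `(x,z)` separates `(y,u)`. -/
def IsPtolemyCircle {X : Type*} (S : MobiusStructure X) (σ : Set X) : Prop :=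
  HomeoToCircle S σ ∧
  ∀ d ∈ S.M, ∀ x ∈ σ, ∀ y ∈ σ, ∀ z ∈ σ, ∀ u ∈ σ,
    x ≠ y → x ≠ z → x ≠ u → y ≠ z → y ≠ u → z ≠ u →
    SeparatesIn S σ x z y u →
    d.d x z * d.d y u = d.d x y * d.d z u + d.d x u * d.d y z

/-- A Möbius automorphism of `X`: a bijection preserving all cross-ratio triples. -/
def IsMobiusAuto {X : Type*} (S : MobiusStructure X) (f : X → X) : Prop :=
  Function.Bijective f ∧ ∀ d ∈ S.M, ∀ x y z u : X, Admissible x y z u →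
    ProjEq (crtVec d x y z u) (crtVec d (f x) (f y) (f z) (f u))

/-- A metric sphere between two distinct points `ω`, `ω'`. -/
def IsMetricSphere {X : Type*} (S : MobiusStructure X) (ω ω' : X) (Sp : Set X) : Prop :=
  ∃ d ∈ S.M, d.rem = some ω' ∧ ∃ r : ℝ≥0∞, 0 < r ∧ r ≠ ⊤ ∧ Sp = {x | d.d x ω = r}

/-- A space inversion with respect to `ω`, `ω'` and a metric sphere `Sp` between them. -/
def IsSpaceInversion {X : Type*} (S : MobiusStructure X) (ω ω' : X) (Sp : Set X)
    (φ : X → X) : Prop :=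
  IsMobiusAuto S φ ∧ Function.Involutive φ ∧ (∀ x, φ x ≠ x) ∧ φ ω = ω' ∧
  φ '' Sp = Sp ∧ ∀ σ : Set X, IsPtolemyCircle S σ → ω ∈ σ → ω' ∈ σ → φ '' σ = σ

/-- Property (E): existence of at least one Ptolemy circle. -/
def PropertyE {X : Type*} (S : MobiusStructure X) : Prop :=
  ∃ σ : Set X, IsPtolemyCircle S σ

/-- Property (I): existence and uniqueness of space inversions. -/
def PropertyI {X : Type*} (S : MobiusStructure X) : Prop :=
  ∀ ω ω' : X, ω ≠ ω' → ∀ Sp : Set X, IsMetricSphere S ω ω' Sp →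
    ∃! φ : X → X, IsSpaceInversion S ω ω' Sp φ

/-- The Möbius space is compact. -/
def MobiusCompact {X : Type*} (S : MobiusStructure X) : Prop :=
  letI : TopologicalSpace X := mobiusTop S
  CompactSpace X

/-- Property (H), the homothety property. -/
def PropertyH {X : Type*} (S : MobiusStructure X) : Prop :=
  ∀ ω ω' : X, ω ≠ ω' → ∀ σ : Set X, IsPtolemyCircle S σ → ω ∈ σ → ω' ∈ σ →
    ∀ x x' : X, x ∈ σ \ {ω, ω'} → x' ∈ mobiusCCIn S (σ \ {ω, ω'}) x →
    ∃ γ : X → X, IsMobiusAuto S γ ∧ γ ω = ω ∧ γ ω' = ω' ∧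
      (∀ σ' : Set X, IsPtolemyCircle S σ' → ω ∈ σ' → ω' ∈ σ' →
        γ '' σ' = σ' ∧ ∀ y ∈ σ' \ {ω, ω'}, γ y ∈ mobiusCCIn S (σ' \ {ω, ω'}) y) ∧
      γ x = x'

/-- A Ptolemy line in `X_ω`: a Ptolemy circle through `ω` with `ω` removed. -/
def IsPtolemyLine {X : Type*} (S : MobiusStructure X) (ω : X) (l : Set X) : Prop :=
  ∃ σ : Set X, IsPtolemyCircle S σ ∧ ω ∈ σ ∧ l = σ \ {ω}

/-- `c : ℝ → X` is a unit-speed parameterization of `l ⊆ X` w.r.t. the metric `d`. -/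
def IsUnitSpeed {X : Type*} (d : ExtMetric X) (l : Set X) (c : ℝ → X) : Prop :=
  Set.range c = l ∧ ∀ s t : ℝ, d.d (c s) (c t) = ENNReal.ofReal |s - t|

/-- `b` is a Busemann function of the Ptolemy line `l ⊆ X_ω`:  up to an additive constant,
`b x = lim_{t→∞} (d(x,c(t)) − t)` for a unit-speed parameterization `c` of `l`. -/
def IsBusemannOf {X : Type*} (S : MobiusStructure X) (d : ExtMetric X) (ω : X)
    (l : Set X) (b : X → ℝ) : Prop :=
  IsPtolemyLine S ω l ∧ ∃ c : ℝ → X, IsUnitSpeed d l c ∧ ∃ C : ℝ, ∀ x : X, x ≠ ω →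
    Filter.Tendsto (fun t => (d.d x (c t)).toReal - t) Filter.atTop (nhds (b x + C))

/-- The fiber through `x` of the canonical fibration `π_ω`: the set of points on which
every Busemann function of every Ptolemy line of `X_ω` takes the same value as at `x`. -/
def mobiusFiber {X : Type*} (S : MobiusStructure X) (d : ExtMetric X) (ω : X) (x : X) :
    Set X :=
  {y | y ≠ ω ∧ ∀ (l : Set X) (b : X → ℝ), IsBusemannOf S d ω l b → b y = b x}

/-- The base `B_ω` of the canonical fibration: the set of all fibers. -/
def mobiusBase {X : Type*} (S : MobiusStructure X) (d : ExtMetric X) (ω : X) :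
    Set (Set X) :=
  {F | ∃ x : X, x ≠ ω ∧ F = mobiusFiber S d ω x}

/-- The distance between two fibers. -/
noncomputable def fiberDist {X : Type*} (d : ExtMetric X) (F F' : Set X) : ℝ :=
  sInf {r : ℝ | ∃ x ∈ F, ∃ x' ∈ F', r = (d.d x x').toReal}

/-- Two Möbius spaces are Möbius equivalent: there is a bijection between them
preserving all cross-ratio triples. -/
def MobiusEquiv {X Y : Type*} (S : MobiusStructure X) (S' : MobiusStructure Y) : Prop :=
  ∃ f : X → Y, Function.Bijective f ∧ ∀ d ∈ S.M, ∀ d' ∈ S'.M, ∀ x y z u : X,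
    Admissible x y z u → ProjEq (crtVec d x y z u) (crtVec d' (f x) (f y) (f z) (f u))

/-- The standard extended Euclidean metric on the one-point extension
`ℝ̂ⁿ = ℝⁿ ∪ {∞}`, where `∞` is encoded by `none`. -/
noncomputable def stdExtMetric (n : ℕ) : ExtMetric (Option (EuclideanSpace ℝ (Fin n))) where
  d x y :=
    match x, y with
    | none, none => 0
    | none, some _ => ⊤
    | some _, none => ⊤
    | some a, some b => ENNReal.ofReal (dist a b)
  rem := some none
  symm := by intro x y; cases x <;> cases y <;> simp [dist_comm]
  d_self := by intro x; cases x <;> simp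
  pos := by
    intro x y h
    cases x <;> cases y
    · exact absurd rfl h
    · simp
    · simp
    · simp only [ne_eq, Option.some.injEq] at h
      exact ENNReal.ofReal_pos.mpr (dist_pos.mpr h)
  triangle := by
    intro x y z
    cases x <;> cases y <;> cases z <;>
      simp only [le_refl, le_top, zero_le, zero_add, add_zero, top_add, add_top,
        top_le_iff]
    rw [← ENNReal.ofReal_add dist_nonneg dist_nonneg]
    exact ENNReal.ofReal_le_ofReal (dist_triangle _ _ _)
  d_eq_top_iff := by
    intro x y
    cases x <;> cases y <;>
      simp [ENNReal.ofReal_ne_top]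

section MetricCore

open Filter Topology Set

/-- The bi-infinite orbit of `x` under a step `F` forwards and a step `B` backwards. -/
def zigzag {Z : Type*} (F B : Z → Z) (x : Z) : ℤ → Z
  | Int.ofNat n => F^[n] x
  | Int.negSucc n => B^[n + 1] x

theorem zigzag_step {Z : Type*} {F B : Z → Z} {R : Z → Z → Prop} (hF : ∀ y, R y (F y))
    (hB : ∀ y, R (B y) y) (x : Z) (k : ℤ) : R (zigzag F B x k) (zigzag F B x (k + 1)) := by
  cases k with
  | ofNat n =>
    change R (F^[n] x) (F^[n + 1] x)
    rw [Function.iterate_succ_apply']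
    exact hF _
  | negSucc n =>
    cases n with
    | zero => exact hB x
    | succ n =>
      change R (B^[n + 1 + 1] x) (B^[n + 1] x)
      rw [Function.iterate_succ_apply' B (n + 1)]
      exact hB _

variable {Y : Type*} [MetricSpace Y]

/-- The Ptolemy inequality for a metric space. -/
def PtolemyIneq (Y : Type*) [MetricSpace Y] : Prop :=
  ∀ x y z u : Y, dist x z * dist y u ≤ dist x y * dist z u + dist x u * dist y z

/-- Every point of `Y` is the centre of metric inversions of all sufficiently large radii which
preserve the geodesic lines through the centre and act there without fixed points. -/
def HasInversions (Y : Type*) [MetricSpace Y] : Prop :=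
  ∀ o : Y, ∃ r₀ : ℝ, ∀ r : ℝ, 0 < r → r₀ ≤ r → ∃ φ : Y → Y,
    (∀ x, x ≠ o → φ x ≠ o ∧ dist (φ x) o * dist x o = r ^ 2) ∧
    (∀ x y, x ≠ o → y ≠ o → dist (φ x) (φ y) * (dist x o * dist y o) = r ^ 2 * dist x y) ∧
    ∀ c : ℝ → Y, Isometry c → c 0 = o → ∀ t, t ≠ 0 → φ (c t) = c (-(r ^ 2 / t))

/-- A homothety with centre `o` and coefficient `k` preserving the geodesic lines through `o`. -/
structure IsPureHomothety (o : Y) (k : ℝ) (f : Y → Y) : Prop where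
  center : f o = o
  dist_map : ∀ x y, dist (f x) (f y) = k * dist x y
  line : ∀ c : ℝ → Y, Isometry c → c 0 = o → ∀ t, f (c t) = c (k * t)

theorem isometry_dist {c : ℝ → Y} (hc : Isometry c) (s t : ℝ) : dist (c s) (c t) = |s - t| := by
  rw [hc.dist_eq, Real.dist_eq]

theorem isometry_of_dist {c : ℝ → Y} (h : ∀ s t, dist (c s) (c t) = |s - t|) : Isometry c :=
  Isometry.of_dist_eq fun s t => by rw [h, Real.dist_eq]

theorem Isometry.rev {c : ℝ → Y} (hc : Isometry c) : Isometry fun t => c (-t) :=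
  isometry_of_dist fun s t => by
    rw [isometry_dist hc, ← abs_neg]
    congr 1
    ring

theorem Isometry.shift {c : ℝ → Y} (hc : Isometry c) (a : ℝ) : Isometry fun t => c (a + t) :=
  isometry_of_dist fun s t => by
    rw [isometry_dist hc]
    congr 1
    ring

theorem HasInversions.exists_homothety (h : HasInversions Y) (o : Y) {k : ℝ} (hk : 0 < k) :
    ∃ f : Y → Y, IsPureHomothety o k f := by
  classical
  obtain ⟨r₀, h⟩ := h o
  have hsk : 0 < √k := Real.sqrt_pos.2 hk
  obtain ⟨s, hs0, hs1, hs2⟩ : ∃ s : ℝ, 0 < s ∧ r₀ ≤ s ∧ r₀ ≤ √k * s := by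
    refine ⟨max 1 (max r₀ (r₀ / √k)), by positivity, by simp, ?_⟩
    have : r₀ / √k ≤ max 1 (max r₀ (r₀ / √k)) := by simp
    calc r₀ = √k * (r₀ / √k) := by field_simp
      _ ≤ _ := by gcongr
  obtain ⟨φ, h1, h2, h3⟩ := h s hs0 hs1
  obtain ⟨ψ, g1, g2, g3⟩ := h (√k * s) (by positivity) hs2
  have hr : (√k * s) ^ 2 = k * s ^ 2 := by rw [mul_pow, Real.sq_sqrt hk.le]
  rw [hr] at g1 g2 g3
  have key : ∀ x, x ≠ o → dist (ψ (φ x)) o = k * dist x o := by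
    intro x hx
    have e1 := (h1 x hx).2
    have e2 := (g1 _ (h1 x hx).1).2
    have p1 : 0 < dist x o := dist_pos.2 hx
    have p2 : 0 < dist (φ x) o := dist_pos.2 (h1 x hx).1
    have : dist (ψ (φ x)) o * dist (φ x) o = k * dist x o * dist (φ x) o := by
      rw [e2, ← e1]; ring
    exact mul_right_cancel₀ p2.ne' this
  refine ⟨fun x => if x = o then o else ψ (φ x), by simp, ?_, ?_⟩
  · intro x y
    by_cases hx : x = o
    · by_cases hy : y = o
      · simp [hx, hy]
      · simp only [hx, hy, if_true, if_false]
        rw [dist_comm, key y hy, dist_comm]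
    · by_cases hy : y = o
      · simp only [hx, hy, if_true, if_false]
        exact key x hx
      · simp only [hx, hy, if_false]
        have e1 := (h1 x hx).2
        have e1' := (h1 y hy).2
        have e2 := h2 x y hx hy
        have e3 := g2 _ _ (h1 x hx).1 (h1 y hy).1
        have p1 : 0 < dist x o := dist_pos.2 hx
        have p2 : 0 < dist y o := dist_pos.2 hy
        have p3 : 0 < dist (φ x) o := dist_pos.2 (h1 x hx).1
        have p4 : 0 < dist (φ y) o := dist_pos.2 (h1 y hy).1
        have e4 : dist (ψ (φ x)) (ψ (φ y)) * (dist (φ x) o * dist (φ y) o) *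
            (dist x o * dist y o) =
            k * dist x y * (dist (φ x) o * dist (φ y) o) * (dist x o * dist y o) := by
          rw [e3]
          calc k * s ^ 2 * dist (φ x) (φ y) * (dist x o * dist y o)
              = k * s ^ 2 * (dist (φ x) (φ y) * (dist x o * dist y o)) := by ring
            _ = k * dist x y * s ^ 2 * s ^ 2 := by rw [e2]; ring
            _ = k * dist x y * (dist (φ x) o * dist x o) * (dist (φ y) o * dist y o) := by
              rw [e1, e1']
            _ = _ := by ring
        have p5 : dist (φ x) o * dist (φ y) o ≠ 0 := by positivity
        have p6 : dist x o * dist y o ≠ 0 := by positivity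
        exact mul_right_cancel₀ p5 (mul_right_cancel₀ p6 e4)
  · intro c hc hc0 t
    by_cases ht : t = 0
    · simp [ht, hc0]
    · have hne : c t ≠ o := fun hh => ht (hc.injective (hh.trans hc0.symm))
      simp only [hne, if_false]
      rw [h3 c hc hc0 t ht, g3 c hc hc0 _ (by simp only [ne_eq, neg_eq_zero]; positivity)]
      congr 1
      field_simp

/-- The Busemann function of a geodesic line, normalized to vanish at parameter zero. -/
noncomputable def bus (c : ℝ → Y) (x : Y) : ℝ := ⨅ t : ℝ, (dist x (c t) - t)

section Busemann

variable {c : ℝ → Y}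

theorem bus_antitone (hc : Isometry c) (x : Y) : Antitone fun t => dist x (c t) - t := by
  intro s t hst
  have h1 := dist_triangle x (c s) (c t)
  rw [isometry_dist hc, abs_sub_comm, abs_of_nonneg (by linarith)] at h1
  simp only
  linarith

theorem bus_bddBelow (hc : Isometry c) (x : Y) :
    BddBelow (range fun t => dist x (c t) - t) := by
  refine ⟨-dist x (c 0), ?_⟩
  rintro _ ⟨t, rfl⟩
  have h1 := dist_triangle (c 0) x (c t)
  rw [isometry_dist hc, dist_comm (c 0) x] at h1
  have h2 : t ≤ |0 - t| := by rw [zero_sub, abs_neg]; exact le_abs_self t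
  simp only
  linarith

theorem bus_le (hc : Isometry c) (x : Y) (t : ℝ) : bus c x ≤ dist x (c t) - t :=
  ciInf_le (bus_bddBelow hc x) t

theorem tendsto_bus (hc : Isometry c) (x : Y) :
    Tendsto (fun t => dist x (c t) - t) atTop (𝓝 (bus c x)) :=
  tendsto_atTop_ciInf (bus_antitone hc x) (bus_bddBelow hc x)

theorem bus_self (hc : Isometry c) (t : ℝ) : bus c (c t) = -t := by
  refine tendsto_nhds_unique (tendsto_bus hc (c t)) ?_
  refine tendsto_const_nhds.congr' ?_
  filter_upwards [eventually_ge_atTop t] with s hs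
  rw [isometry_dist hc, abs_sub_comm, abs_of_nonneg (by linarith)]
  ring

theorem bus_sub_le (hc : Isometry c) (x y : Y) : bus c x - bus c y ≤ dist x y := by
  refine le_of_tendsto' ((tendsto_bus hc x).sub (tendsto_bus hc y)) fun t => ?_
  have := dist_triangle x y (c t)
  linarith

theorem abs_bus_sub_le (hc : Isometry c) (x y : Y) : |bus c x - bus c y| ≤ dist x y := by
  refine abs_le.2 ⟨?_, bus_sub_le hc x y⟩
  have := bus_sub_le hc y x
  rw [dist_comm] at this
  linarith

theorem continuous_bus (hc : Isometry c) : Continuous (bus c) :=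
  (LipschitzWith.of_dist_le_mul (K := 1) fun x y => by
    simpa [Real.dist_eq] using abs_bus_sub_le hc x y).continuous

theorem PtolemyIneq.convexOn_dist (hP : PtolemyIneq Y) (hc : Isometry c) (x : Y) :
    ConvexOn ℝ univ fun t => dist x (c t) := by
  refine ⟨convex_univ, fun s _ t _ a b ha hb hab => ?_⟩
  simp only [smul_eq_mul]
  rcases eq_or_ne s t with rfl | hst
  · rw [← add_mul, ← add_mul, hab, one_mul, one_mul]
  · have h := hP x (c s) (c (a * s + b * t)) (c t)
    rw [isometry_dist hc, isometry_dist hc, isometry_dist hc] at h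
    have e1 : a * s + b * t - t = a * (s - t) := by
      rw [← eq_sub_iff_add_eq'] at hab; rw [hab]; ring
    have e2 : s - (a * s + b * t) = b * (s - t) := by
      rw [← eq_sub_iff_add_eq] at hab; rw [hab]; ring
    rw [e1, e2, abs_mul, abs_mul, abs_of_nonneg ha, abs_of_nonneg hb] at h
    have hp : 0 < |s - t| := abs_pos.2 (sub_ne_zero.2 hst)
    refine le_of_mul_le_mul_right ?_ hp
    linarith

theorem PtolemyIneq.convexOn_bus (hP : PtolemyIneq Y) (hc : Isometry c) {e : ℝ → Y}
    (he : Isometry e) : ConvexOn ℝ univ fun t => bus c (e t) := by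
  refine ⟨convex_univ, fun s _ t _ a b ha hb hab => ?_⟩
  simp only [smul_eq_mul]
  refine le_of_tendsto_of_tendsto' (tendsto_bus hc (e (a * s + b * t)))
    (((tendsto_bus hc (e s)).const_mul a).add ((tendsto_bus hc (e t)).const_mul b)) fun u => ?_
  have h := (hP.convexOn_dist he (c u)).2 (mem_univ s) (mem_univ t) ha hb hab
  simp only [smul_eq_mul, dist_comm (c u)] at h
  have e1 : a * u + b * u = u := by rw [← add_mul, hab, one_mul]
  linarith

end Busemann

theorem tendsto_secondDiff_of_convexOn {f : ℝ → ℝ} (hf : ConvexOn ℝ univ f) :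
    Tendsto (fun t => (f (2 * t) + f 0 - 2 * f t) / t) (𝓝[>] 0) (𝓝 0) := by
  have hd := (hf.differentiableWithinAt_Ioi_of_mem_interior (x := 0) (by simp)).hasDerivWithinAt
  rw [hasDerivWithinAt_iff_tendsto_slope' (by simp)] at hd
  set D := derivWithin f (Ioi 0) 0
  have h2 : Tendsto (fun t : ℝ => 2 * t) (𝓝[>] 0) (𝓝[>] 0) := by
    refine tendsto_nhdsWithin_iff.2 ⟨?_, ?_⟩
    · have : Tendsto (fun t : ℝ => 2 * t) (𝓝 0) (𝓝 (2 * 0)) := by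
        exact (continuous_const.mul continuous_id).tendsto 0
      rw [mul_zero] at this
      exact this.mono_left nhdsWithin_le_nhds
    · filter_upwards [self_mem_nhdsWithin] with t ht
      simpa using ht
  have h3 := ((hd.comp h2).const_mul 2).sub (hd.const_mul 2)
  rw [sub_self] at h3
  refine h3.congr' ?_
  filter_upwards [self_mem_nhdsWithin] with t ht
  have : t ≠ 0 := ne_of_gt ht
  simp only [Function.comp, slope_def_field]
  field_simp
  ring

/-- Two geodesic lines sharing two points coincide. -/
theorem isometry_eq_of_eq_at_two (hI : HasInversions Y) {c e : ℝ → Y} (hc : Isometry c)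
    (he : Isometry e) {s t : ℝ} (hst : s < t) (hs : c s = e s) (ht : c t = e t) : c = e := by
  have ray : ∀ s t, c s = e s → c t = e t → ∀ k, 0 < k → c (s + k * (t - s)) =
      e (s + k * (t - s)) := by
    intro s t hs ht k hk
    obtain ⟨f, hf⟩ := hI.exists_homothety (c s) hk
    have h1 := hf.line (fun u => c (s + u)) (Isometry.shift hc s) (by simp) (t - s)
    have h2 := hf.line (fun u => e (s + u)) (Isometry.shift he s) (by simp [hs]) (t - s)
    rw [← h1, ← h2, add_sub_cancel, ht]
  funext u
  have hpos : 0 < t - s := sub_pos.2 hst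
  rcases lt_or_ge s u with hu | hu
  · have := ray s t hs ht ((u - s) / (t - s)) (div_pos (sub_pos.2 hu) hpos)
    rwa [show s + (u - s) / (t - s) * (t - s) = u by field_simp; ring] at this
  · have := ray t s ht hs ((t - u) / (t - s)) (div_pos (by linarith) hpos)
    rwa [show t + (t - u) / (t - s) * (s - t) = u by field_simp; ring] at this

/-- Two geodesic rays from one point reaching points with equal Busemann coordinates lie on the
same geodesic line. -/
theorem isometry_eq_of_bus_eq (hI : HasInversions Y) {c e : ℝ → Y} (hc : Isometry c)
    (he : Isometry e) (h0 : c 0 = e 0) {s t : ℝ} (hs : 0 < s) (ht : 0 < t)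
    (h : ∀ b : ℝ → Y, Isometry b → bus b (c s) = bus b (e t)) : c = e := by
  have hst : s = t := by
    have h1 := h c hc
    have h2 := h e he
    have h3 := bus_sub_le hc (c 0) (e t)
    have h4 := bus_sub_le he (e 0) (c s)
    rw [← h1, bus_self hc, bus_self hc, h0, isometry_dist he, zero_sub, abs_neg,
      abs_of_pos ht] at h3
    rw [h2, bus_self he, bus_self he, ← h0, isometry_dist hc, zero_sub, abs_neg,
      abs_of_pos hs] at h4
    linarith
  subst hst
  have hr := Isometry.rev hc
  have hb : bus (fun t => c (-t)) (e s) = s := by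
    rw [← h _ hr]
    have := bus_self hr (-s)
    simpa using this
  have hbroken : ∀ u, 0 ≤ u → ∀ v, 0 < v → dist (c (-u)) (e v) = u + v := by
    intro u hu v hv
    refine le_antisymm ?_ ?_
    · refine (dist_triangle (c (-u)) (c 0) (e v)).trans ?_
      rw [isometry_dist hc, h0, isometry_dist he, zero_sub, abs_neg, abs_of_pos hv, sub_zero,
        abs_neg, abs_of_nonneg hu]
    · obtain ⟨f, hf⟩ := hI.exists_homothety (c 0) (div_pos hv hs)
      have h1 := bus_le hr (e s) (s / v * u)
      rw [hb, dist_comm] at h1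
      have h2 := hf.line c hc rfl (-(s / v * u))
      have h3 := hf.line e he h0.symm s
      rw [show v / s * -(s / v * u) = -u by field_simp] at h2
      rw [show v / s * s = v by field_simp] at h3
      rw [← h2, ← h3, hf.dist_map, div_mul_eq_mul_div, le_div_iff₀ hs]
      have h4 : (s + s / v * u) * v ≤ dist (c (-(s / v * u))) (e s) * v := by
        gcongr
        linarith
      have h5 : (s + s / v * u) * v = (u + v) * s := by
        field_simp
        ring
      linarith
  set g : ℝ → Y := fun u => if u ≤ 0 then c u else e u with hg
  have hgi : Isometry g := isometry_of_dist fun u v => by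
    simp only [hg]
    rcases le_or_gt u 0 with hu | hu <;> rcases le_or_gt v 0 with hv | hv
    · rw [if_pos hu, if_pos hv, isometry_dist hc]
    · rw [if_pos hu, if_neg hv.not_ge]
      have := hbroken (-u) (by linarith) v hv
      rw [neg_neg] at this
      rw [this, abs_of_nonpos (by linarith)]
      ring
    · rw [if_neg hu.not_ge, if_pos hv, dist_comm]
      have := hbroken (-v) (by linarith) u hu
      rw [neg_neg] at this
      rw [this, abs_of_nonneg (by linarith)]
      ring
    · rw [if_neg hu.not_ge, if_neg hv.not_ge, isometry_dist he]
  have hgc : g = c := isometry_eq_of_eq_at_two hI hgi hc (s := -1) (t := 0) (by norm_num)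
    (by simp [hg]) (by simp [hg])
  refine isometry_eq_of_eq_at_two hI hc he one_pos.gt h0 ?_
  rw [← hgc]
  simp only [hg]
  rw [if_neg (by norm_num)]

/-- A geodesic line joining a point to a set of points with fixed Busemann coordinates is unique. -/
theorem range_eq_of_bus_eq (hI : HasInversions Y) {c e : ℝ → Y} (hc : Isometry c)
    (he : Isometry e) (h0 : c 0 = e 0) {s t : ℝ} (hs : s ≠ 0) (ht : t ≠ 0)
    (h : ∀ b : ℝ → Y, Isometry b → bus b (c s) = bus b (e t)) : range c = range e := by
  have orient : ∀ {c : ℝ → Y}, Isometry c → ∀ {s : ℝ}, s ≠ 0 → ∃ c' : ℝ → Y, Isometry c' ∧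
      range c' = range c ∧ c' 0 = c 0 ∧ ∃ s', 0 < s' ∧ c' s' = c s := by
    intro c hc s hs
    rcases hs.lt_or_gt with hs | hs
    · refine ⟨_, Isometry.rev hc, ?_, by simp, -s, by linarith, by simp⟩
      exact (Equiv.neg ℝ).surjective.range_comp c
    · exact ⟨c, hc, rfl, rfl, s, hs, rfl⟩
  obtain ⟨c', hc', hrc, hc0, s', hs', hcs⟩ := orient hc hs
  obtain ⟨e', he', hre, he0, t', ht', het⟩ := orient he ht
  rw [← hrc, ← hre, isometry_eq_of_bus_eq hI hc' he' (by rw [hc0, he0, h0]) hs' ht'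
    (by rw [hcs, het]; exact h)]

variable [ProperSpace Y]

/-- The distance from a point to a geodesic line has no corner: blow-up constants of its second
differences are nonpositive. -/
theorem secondDiff_const_nonpos (hP : PtolemyIneq Y) (hI : HasInversions Y) {c : ℝ → Y}
    (hc : Isometry c) {x : Y} (hx : x ≠ c 0) {j : ℝ}
    (hj : ∀ ε : ℝ, 0 < ε → j * ε ≤ dist x (c ε) + dist x (c (-ε)) - 2 * dist x (c 0)) :
    j ≤ 0 := by
  set T : ℕ → ℝ := fun n => 1 / ((n : ℝ) + 1) with hT
  have hTpos : ∀ n, 0 < T n := fun n => by simp only [hT]; positivity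
  have hTle : ∀ n, T n ≤ 1 := fun n => by
    simp only [hT]
    rw [div_le_one (by positivity)]
    have : (0 : ℝ) ≤ n := by positivity
    linarith
  have hT0 : Tendsto T atTop (𝓝 0) := tendsto_one_div_add_atTop_nhds_zero_nat
  have hhom : ∀ n, ∃ y : Y, (∀ s, dist y (c (T n + (1 + T n) * s)) = (1 + T n) * dist x (c s)) ∧
      dist y (c (-1)) = (1 + T n) * dist x (c (-1)) := by
    intro n
    obtain ⟨f, hf⟩ := hI.exists_homothety (c (-1)) (k := 1 + T n) (by linarith [hTpos n])
    refine ⟨f x, fun s => ?_, ?_⟩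
    · rw [← hf.dist_map]
      have h1 : f (c (-1 + (s + 1))) = c (-1 + (1 + T n) * (s + 1)) :=
        hf.line (fun t => c (-1 + t)) (Isometry.shift hc (-1)) (by simp) (s + 1)
      rw [show -1 + (s + 1) = s by ring] at h1
      rw [h1]
      congr 2
      ring
    · rw [← hf.dist_map, hf.center]
  choose y hy1 hy2 using hhom
  have hbdd : Bornology.IsBounded (range y) := by
    refine (Metric.isBounded_closedBall (x := c (-1)) (r := 2 * dist x (c (-1)))).subset ?_
    rintro _ ⟨n, rfl⟩
    rw [Metric.mem_closedBall, hy2]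
    have := hTle n
    gcongr
    linarith
  obtain ⟨z, -, g, hg, hlim⟩ := tendsto_subseq_of_bounded hbdd (x := y) fun n => mem_range_self n
  have hTg : Tendsto (fun n => T (g n)) atTop (𝓝 0) := hT0.comp hg.tendsto_atTop
  have hTg' : Tendsto (fun n => T (g n)) atTop (𝓝[>] 0) :=
    tendsto_nhdsWithin_iff.2 ⟨hTg, Eventually.of_forall fun n => hTpos _⟩
  have hcT : Tendsto (fun n => c (T (g n))) atTop (𝓝 (c 0)) :=
    (hc.continuous.tendsto 0).comp hTg
  have hA : ∀ n, dist (y n) (c (T n)) = (1 + T n) * dist x (c 0) := fun n => by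
    simpa using hy1 n 0
  have hAlim : Tendsto (fun n => dist (y (g n)) (c (T (g n)))) atTop (𝓝 (dist x (c 0))) := by
    have := (hTg.const_add 1).mul_const (dist x (c 0))
    rw [add_zero, one_mul] at this
    exact this.congr fun n => (hA (g n)).symm
  have hz : dist z (c 0) = dist x (c 0) :=
    tendsto_nhds_unique (hlim.dist hcT) hAlim
  have hfz : Tendsto (fun n => dist z (c (T (g n)))) atTop (𝓝 (dist z (c 0))) :=
    tendsto_const_nhds.dist hcT
  have hQ := (tendsto_secondDiff_of_convexOn (hP.convexOn_dist hc z)).comp hTg'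
  have hdist : Tendsto (fun n => dist (y (g n)) z) atTop (𝓝 0) := by
    have := hlim.dist (tendsto_const_nhds (x := z))
    simpa using this
  have hineq : ∀ n, j * dist z (c (T n)) ≤ dist (y n) (c (T n)) *
      ((dist z (c (2 * T n)) + dist z (c 0) - 2 * dist z (c (T n))) / T n) +
      2 * dist (y n) z := by
    intro n
    have ht := hTpos n
    have a1 : dist (y n) (c (2 * T n)) = (1 + T n) * dist x (c (T n / (1 + T n))) := by
      rw [← hy1]
      congr 2
      field_simp
      ring
    have a2 : dist (y n) (c 0) = (1 + T n) * dist x (c (-(T n / (1 + T n)))) := by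
      rw [← hy1]
      congr 2
      field_simp
      ring
    have a3 := hj (T n / (1 + T n)) (by positivity)
    have a4 : j * T n ≤ dist (y n) (c (2 * T n)) + dist (y n) (c 0) - 2 * dist (y n) (c (T n)) := by
      rw [a1, a2, hA]
      calc j * T n = (1 + T n) * (j * (T n / (1 + T n))) := by field_simp
        _ ≤ (1 + T n) * _ := mul_le_mul_of_nonneg_left a3 (by linarith)
        _ = _ := by ring
    have b1 := hP (y n) z (c (2 * T n)) (c (T n))
    have b2 := hP (y n) z (c 0) (c (T n))
    rw [isometry_dist hc, show 2 * T n - T n = T n by ring, abs_of_pos ht] at b1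
    rw [isometry_dist hc, show 0 - T n = -T n by ring, abs_neg, abs_of_pos ht] at b2
    have a5 := mul_le_mul_of_nonneg_right a4 (dist_nonneg (x := z) (y := c (T n)))
    have : j * dist z (c (T n)) * T n ≤ (dist (y n) (c (T n)) *
      ((dist z (c (2 * T n)) + dist z (c 0) - 2 * dist z (c (T n))) / T n) +
      2 * dist (y n) z) * T n := by
      have e : (dist (y n) (c (T n)) *
          ((dist z (c (2 * T n)) + dist z (c 0) - 2 * dist z (c (T n))) / T n) +
          2 * dist (y n) z) * T n = dist (y n) (c (T n)) *
          (dist z (c (2 * T n)) + dist z (c 0) - 2 * dist z (c (T n))) +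
          2 * dist (y n) z * T n := by
        field_simp
      rw [e]
      linarith
    exact le_of_mul_le_mul_right this ht
  have hfin := le_of_tendsto_of_tendsto' (hfz.const_mul j)
    ((hAlim.mul hQ).add (hdist.const_mul 2)) fun n => hineq (g n)
  rw [hz] at hfin
  have hpos : 0 < dist x (c 0) := dist_pos.2 hx
  by_contra! hcon
  have := mul_pos hcon hpos
  linarith

/-- Opposite Busemann functions of a geodesic line sum up to zero. -/
theorem bus_add_bus_rev (hP : PtolemyIneq Y) (hI : HasInversions Y) {c : ℝ → Y}
    (hc : Isometry c) (x : Y) : bus c x + bus (fun t => c (-t)) x = 0 := by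
  have hr := Isometry.rev hc
  refine le_antisymm ?_ ?_
  · by_cases hx : x = c 0
    · have h1 := bus_self hc 0
      have h2 := bus_self hr 0
      simp only [neg_zero] at h1 h2
      rw [hx, h1, h2, add_zero]
    · obtain ⟨r₀, h⟩ := hI (c 0)
      obtain ⟨φ, h1, h2, h3⟩ := h (max 1 r₀) (by positivity) (by simp)
      set K := (max 1 r₀) ^ 2
      have hK : 0 < K := by positivity
      set D := dist x (c 0) with hD
      have hDpos : 0 < D := dist_pos.2 hx
      have key : ∀ t, t ≠ 0 → dist (φ x) (c (-(K / t))) * (D * |t|) = K * dist x (c t) := by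
        intro t ht
        have := h2 x (c t) hx (fun hh => ht (hc.injective hh))
        rw [h3 c hc rfl t ht, isometry_dist hc, sub_zero] at this
        exact this
      have hno := secondDiff_const_nonpos hP hI hc (h1 x hx).1
        (j := (bus c x + bus (fun t => c (-t)) x) / D) ?_
      · by_contra! hcon
        have := div_pos hcon hDpos
        linarith
      · intro ε hε
        have k1 := key (-(K / ε)) (by simp only [ne_eq, neg_eq_zero]; positivity)
        have k2 := key (K / ε) (by positivity)
        rw [abs_neg, show -(K / -(K / ε)) = ε by field_simp] at k1
        rw [show -(K / (K / ε)) = -ε by field_simp] at k2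
        rw [abs_of_pos (by positivity)] at k1 k2
        have l1 := bus_le hc x (K / ε)
        have l2 := bus_le hr x (K / ε)
        have k0 := (h1 x hx).2
        have m1 : dist x (c (-(K / ε))) = dist (φ x) (c ε) * D / ε := by
          field_simp
          field_simp at k1
          linarith
        have m2 : dist x (c (K / ε)) = dist (φ x) (c (-ε)) * D / ε := by
          field_simp
          field_simp at k2
          linarith
        rw [m1] at l2
        rw [m2] at l1
        rw [← k0, ← hD] at l1 l2
        have : bus c x + bus (fun t => c (-t)) x ≤
            (dist (φ x) (c ε) + dist (φ x) (c (-ε)) - 2 * dist (φ x) (c 0)) * D / ε := by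
          calc _ ≤ _ := add_le_add l1 l2
            _ = _ := by ring
        rw [le_div_iff₀ hε] at this
        rw [div_mul_eq_mul_div, div_le_iff₀ hDpos]
        exact this
  · refine ge_of_tendsto' ((tendsto_bus hc x).add (tendsto_bus hr x)) fun t => ?_
    have h1 := dist_triangle (c t) x (c (-t))
    rw [isometry_dist hc, dist_comm (c t) x] at h1
    have h2 := le_abs_self (t - -t)
    linarith

theorem bus_rev (hP : PtolemyIneq Y) (hI : HasInversions Y) {c : ℝ → Y}
    (hc : Isometry c) (x : Y) : bus (fun t => c (-t)) x = -bus c x := by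
  linarith [bus_add_bus_rev hP hI hc x]

/-- Busemann functions are affine along geodesic lines. -/
theorem bus_affine (hP : PtolemyIneq Y) (hI : HasInversions Y) {c e : ℝ → Y}
    (hc : Isometry c) (he : Isometry e) {a b : ℝ} (ha : 0 ≤ a) (hb : 0 ≤ b) (hab : a + b = 1)
    (s t : ℝ) : bus c (e (a * s + b * t)) = a * bus c (e s) + b * bus c (e t) := by
  have h1 := (hP.convexOn_bus hc he).2 (mem_univ s) (mem_univ t) ha hb hab
  have h2 := (hP.convexOn_bus (Isometry.rev hc) he).2 (mem_univ s) (mem_univ t) ha hb hab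
  simp only [smul_eq_mul, bus_rev hP hI hc] at h1 h2
  linarith

theorem exists_hyperfilter_lim {u : ℕ → Y} {o : Y} {R : ℝ} (h : ∀ n, dist (u n) o ≤ R) :
    ∃ p, Tendsto u (hyperfilter ℕ : Filter ℕ) (𝓝 p) := by
  obtain ⟨p, -, hp⟩ := (isCompact_closedBall o R).ultrafilter_le_nhds ((hyperfilter ℕ).map u)
    (by
      simp only [le_principal_iff, Ultrafilter.mem_coe, Ultrafilter.mem_map]
      exact Filter.mem_of_superset Filter.univ_mem fun n _ => h n)
  exact ⟨p, hp⟩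

theorem hyperfilter_nat_le_atTop : (hyperfilter ℕ : Filter ℕ) ≤ atTop := by
  rw [← Nat.cofinite_eq_atTop]
  exact hyperfilter_le_cofinite

theorem tendsto_hyperfilter_inv :
    Tendsto (fun n : ℕ => 1 / ((n : ℝ) + 1)) (hyperfilter ℕ : Filter ℕ) (𝓝 0) :=
  tendsto_one_div_add_atTop_nhds_zero_nat.mono_left hyperfilter_nat_le_atTop

/-- Through every point there is a geodesic line Busemann parallel to a given one. -/
theorem exists_parallel (hP : PtolemyIneq Y) (hI : HasInversions Y) {c : ℝ → Y}
    (hc : Isometry c) (o : Y) :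
    ∃ m : ℝ → Y, Isometry m ∧ m 0 = o ∧ ∀ y, bus c y = bus c o + bus m y := by
  set T : ℕ → ℝ := fun n => 1 / ((n : ℝ) + 1) with hT
  have hTpos : ∀ n, 0 < T n := fun n => by simp only [hT]; positivity
  have hTle : ∀ n, T n ≤ 1 := fun n => by
    simp only [hT]
    rw [div_le_one (by positivity)]
    have : (0 : ℝ) ≤ n := by positivity
    linarith
  have hT0 : Tendsto T (hyperfilter ℕ : Filter ℕ) (𝓝 0) := tendsto_hyperfilter_inv
  choose f hf using fun n => hI.exists_homothety o (hTpos n)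
  have hd : ∀ n s t, dist (f n (c (s / T n))) (f n (c (t / T n))) = |s - t| := by
    intro n s t
    rw [(hf n).dist_map, isometry_dist hc, ← sub_div, abs_div, abs_of_pos (hTpos n)]
    have := hTpos n
    field_simp
  have hd0 : ∀ n, dist (f n (c (0 / T n))) o = T n * dist (c 0) o := by
    intro n
    conv_lhs => rw [← (hf n).center]
    rw [(hf n).dist_map, zero_div]
  have hbd : ∀ t n, dist (f n (c (t / T n))) o ≤ |t| + dist (c 0) o := by
    intro t n
    have h1 := dist_triangle (f n (c (t / T n))) (f n (c (0 / T n))) o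
    rw [hd, hd0, sub_zero] at h1
    have h2 : T n * dist (c 0) o ≤ 1 * dist (c 0) o := by
      gcongr
      exact hTle n
    linarith
  choose m hm using fun t => exists_hyperfilter_lim (hbd t)
  have hmi : Isometry m := isometry_of_dist fun s t => by
    refine tendsto_nhds_unique ((hm s).dist (hm t)) ?_
    simp only [hd]
    exact tendsto_const_nhds
  have hm0 : m 0 = o := by
    refine tendsto_nhds_unique (hm 0) (tendsto_iff_dist_tendsto_zero.2 ?_)
    simp only [hd0]
    simpa using hT0.mul_const (dist (c 0) o)
  have key : ∀ t, 0 < t → bus c (m t) ≤ bus c o - t := by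
    intro t ht
    have hup : ∀ n, bus c (m t) ≤
        (1 - T n) * bus c o + (dist (m t) (f n (c (t / T n))) - t) := by
      intro n
      have hp := hTpos n
      have h1 := bus_affine hP hI hc hmi (a := 1 - T n) (b := T n) (by linarith [hTle n])
        hp.le (by ring) 0 (t / T n)
      rw [show (1 - T n) * 0 + T n * (t / T n) = t by field_simp; ring, hm0] at h1
      have h2 := mul_le_mul_of_nonneg_left (bus_le hc (m (t / T n)) (t / T n)) hp.le
      rw [mul_sub, ← (hf n).dist_map, (hf n).line m hmi hm0,
        show T n * (t / T n) = t by field_simp] at h2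
      linarith
    have hlim : Tendsto (fun n => (1 - T n) * bus c o + (dist (m t) (f n (c (t / T n))) - t))
        (hyperfilter ℕ : Filter ℕ) (𝓝 ((1 - 0) * bus c o + (dist (m t) (m t) - t))) :=
      ((hT0.const_sub 1).mul_const _).add ((tendsto_const_nhds.dist (hm t)).sub_const t)
    have := ge_of_tendsto' hlim hup
    rw [dist_self] at this
    linarith
  have key' : ∀ t, 0 < t → bus c o + t ≤ bus c (m (-t)) := by
    intro t ht
    have h1 := bus_affine hP hI hc hmi (a := 1 / 2) (b := 1 / 2) (by norm_num) (by norm_num)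
      (by norm_num) t (-t)
    rw [show (1 : ℝ) / 2 * t + 1 / 2 * -t = 0 by ring, hm0] at h1
    have := key t ht
    linarith
  refine ⟨m, hmi, hm0, fun y => le_antisymm ?_ ?_⟩
  · have : bus c y - bus c o ≤ bus m y := by
      refine ge_of_tendsto (tendsto_bus hmi y) ?_
      filter_upwards [eventually_gt_atTop 0] with t ht
      have h1 := bus_sub_le hc y (m t)
      have h2 := key t ht
      linarith
    linarith
  · have hmr := Isometry.rev hmi
    have : bus c o - bus c y ≤ bus (fun t => m (-t)) y := by
      refine ge_of_tendsto (tendsto_bus hmr y) ?_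
      filter_upwards [eventually_gt_atTop 0] with t ht
      have h1 := bus_sub_le hc (m (-t)) y
      have h2 := key' t ht
      rw [dist_comm] at h1
      linarith
    rw [bus_rev hP hI hmi] at this
    linarith

/-- Pure homotheties act on Busemann functions by scaling. -/
theorem IsPureHomothety.bus_map (hP : PtolemyIneq Y) (hI : HasInversions Y) {c : ℝ → Y}
    (hc : Isometry c) {o : Y} {k : ℝ} (hk : 0 < k) {f : Y → Y} (hf : IsPureHomothety o k f)
    (y : Y) : bus c (f y) = bus c o + k * (bus c y - bus c o) := by
  obtain ⟨m, hm, hm0, hb⟩ := exists_parallel hP hI hc o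
  have h : bus m (f y) = k * bus m y := by
    have h1 : Tendsto (fun t : ℝ => k * t) atTop atTop := tendsto_id.const_mul_atTop hk
    refine tendsto_nhds_unique ((tendsto_bus hm (f y)).comp h1) ?_
    refine ((tendsto_bus hm y).const_mul k).congr fun t => ?_
    simp only [Function.comp]
    rw [← hf.line m hm hm0, hf.dist_map]
    ring
  rw [hb (f y), hb y, h]
  ring

/-- Any displacement of Busemann coordinates realized at one point is realized, with no larger
distance, at any other point. -/
theorem exists_translate (hP : PtolemyIneq Y) (hI : HasInversions Y) (p z p' : Y) :
    ∃ z', (∀ c : ℝ → Y, Isometry c → bus c z' - bus c p' = bus c z - bus c p) ∧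
      dist p' z' ≤ dist p z := by
  set T : ℕ → ℝ := fun n => 1 / ((n : ℝ) + 1) with hT
  have hTpos : ∀ n, 0 < T n := fun n => by simp only [hT]; positivity
  have hTle : ∀ n, T n ≤ 1 := fun n => by
    simp only [hT]
    rw [div_le_one (by positivity)]
    have : (0 : ℝ) ≤ n := by positivity
    linarith
  have hT0 : Tendsto T (hyperfilter ℕ : Filter ℕ) (𝓝 0) := tendsto_hyperfilter_inv
  choose f hf using fun n => hI.exists_homothety p' (hTpos n)
  choose g hg using fun n => hI.exists_homothety p (inv_pos.2 (hTpos n))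
  have hdp : ∀ n, dist (f n (g n p)) p' = T n * dist p p' := fun n => by
    rw [(hg n).center]
    conv_lhs => rw [← (hf n).center]
    rw [(hf n).dist_map]
  have hdz : ∀ n, dist (f n (g n p)) (f n (g n z)) = dist p z := fun n => by
    rw [(hf n).dist_map, (hg n).dist_map]
    have := hTpos n
    field_simp
  have hle : ∀ n, dist (f n (g n z)) p' ≤ T n * dist p p' + dist p z := fun n => by
    have := dist_triangle (f n (g n z)) (f n (g n p)) p'
    rw [dist_comm (f n (g n z)) (f n (g n p)), hdz, hdp] at this
    linarith
  have hbd : ∀ n, dist (f n (g n z)) p' ≤ dist p p' + dist p z := fun n => by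
    have h2 : T n * dist p p' ≤ 1 * dist p p' := by
      gcongr
      exact hTle n
    linarith [hle n]
  obtain ⟨z', hz'⟩ := exists_hyperfilter_lim hbd
  refine ⟨z', fun c hc => ?_, ?_⟩
  · have h1 := ((continuous_bus hc).tendsto z').comp hz'
    have h2 : Tendsto (fun n => bus c p' + T n * (bus c p - bus c p') + (bus c z - bus c p))
        (hyperfilter ℕ : Filter ℕ)
        (𝓝 (bus c p' + 0 * (bus c p - bus c p') + (bus c z - bus c p))) :=
      ((hT0.mul_const _).const_add _).add_const _
    have h3 := tendsto_nhds_unique h1 (h2.congr fun n => ?_)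
    · rw [h3]; ring
    · have := hTpos n
      simp only [Function.comp]
      rw [(hf n).bus_map hP hI hc this, (hg n).bus_map hP hI hc (inv_pos.2 this)]
      field_simp
      ring
  · rw [dist_comm]
    refine le_of_tendsto_of_tendsto' (hz'.dist tendsto_const_nhds) ?_ hle
    simpa using (hT0.mul_const (dist p p')).add_const (dist p z)

/-- From `x` there is a geodesic line to some point with the Busemann coordinates of `y`. -/
theorem exists_line (hP : PtolemyIneq Y) (hI : HasInversions Y) {x y : Y}
    (hxy : ∃ c : ℝ → Y, Isometry c ∧ bus c y ≠ bus c x) :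
    ∃ e : ℝ → Y, Isometry e ∧ e 0 = x ∧
      ∃ a : ℝ, ∀ c : ℝ → Y, Isometry c → bus c (e a) = bus c y := by
  set w : (ℝ → Y) → ℝ := fun c => bus c y - bus c x with hw
  have hclosed : IsClosed {z | ∀ c : ℝ → Y, Isometry c → bus c z = bus c y} := by
    simp only [Set.ofPred_forall]
    exact isClosed_iInter fun c => isClosed_iInter fun hc =>
      isClosed_eq (continuous_bus hc) continuous_const
  obtain ⟨z₀, hz₀, hmin⟩ := hclosed.exists_infDist_eq_dist ⟨y, fun c _ => rfl⟩ x
  set a := dist x z₀ with ha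
  have hapos : 0 < a := by
    obtain ⟨c, hc, hne⟩ := hxy
    refine dist_pos.2 fun hh => hne ?_
    rw [hh]
    exact (hz₀ c hc).symm
  have hlow : ∀ p z, (∀ c : ℝ → Y, Isometry c → bus c z - bus c p = w c) → a ≤ dist p z := by
    intro p z hpz
    obtain ⟨z', h1, h2⟩ := exists_translate hP hI p z x
    refine le_trans ?_ h2
    rw [← hmin]
    refine Metric.infDist_le_dist_of_mem fun c hc => ?_
    have e1 := h1 c hc
    rw [hpz c hc] at e1
    simp only [hw] at e1
    linarith
  have hFex : ∀ p, ∃ z, (∀ c : ℝ → Y, Isometry c → bus c z - bus c p = w c) ∧ dist p z ≤ a := by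
    intro p
    obtain ⟨z', h1, h2⟩ := exists_translate hP hI x z₀ p
    exact ⟨z', fun c hc => by rw [h1 c hc, hz₀ c hc], h2⟩
  have hBex : ∀ p, ∃ z, (∀ c : ℝ → Y, Isometry c → bus c p - bus c z = w c) ∧ dist z p ≤ a := by
    intro p
    obtain ⟨z', h1, h2⟩ := exists_translate hP hI z₀ x p
    refine ⟨z', fun c hc => ?_, ?_⟩
    · have := h1 c hc
      rw [hz₀ c hc] at this
      simp only [hw]
      linarith
    · rw [dist_comm, ha, dist_comm x]
      exact h2
  choose F hF using hFex
  choose B hB using hBex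
  set Z := zigzag F B x with hZ
  have hZ0 : Z 0 = x := rfl
  have hstep : ∀ k : ℤ, (∀ c : ℝ → Y, Isometry c → bus c (Z (k + 1)) - bus c (Z k) = w c) ∧
      dist (Z k) (Z (k + 1)) ≤ a :=
    zigzag_step (R := fun p z => (∀ c : ℝ → Y, Isometry c → bus c z - bus c p = w c) ∧
      dist p z ≤ a) hF hB x
  have hbus : ∀ (k : ℤ) (c : ℝ → Y), Isometry c → bus c (Z k) = bus c x + k * w c := by
    intro k c hc
    induction k using Int.induction_on with
    | zero => simp [hZ0]
    | succ n ih =>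
      have := (hstep n).1 c hc
      push_cast at ih ⊢
      linarith
    | pred n ih =>
      have := (hstep (-n - 1)).1 c hc
      rw [sub_add_cancel] at this
      push_cast at ih ⊢
      linarith
  have hup : ∀ (i : ℤ) (n : ℕ), dist (Z i) (Z (i + n)) ≤ n * a := by
    intro i n
    induction n with
    | zero => simp
    | succ n ih =>
      have h1 := dist_triangle (Z i) (Z (i + n)) (Z (i + n + 1))
      have h2 := (hstep (i + n)).2
      push_cast
      rw [← add_assoc]
      linarith
  have hdist' : ∀ (i : ℤ) (n : ℕ), dist (Z i) (Z (i + n)) = n * a := by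
    intro i n
    refine le_antisymm (hup i n) ?_
    rcases Nat.eq_zero_or_pos n with rfl | hn
    · simp
    · have hn' : (0 : ℝ) < n := by exact_mod_cast hn
      obtain ⟨f, hf⟩ := hI.exists_homothety (Z i) (inv_pos.2 hn')
      have h1 := hlow (Z i) (f (Z (i + n))) fun c hc => by
        rw [hf.bus_map hP hI hc (inv_pos.2 hn'), hbus _ c hc, hbus _ c hc]
        push_cast
        field_simp
        ring
      have h2 : dist (Z i) (f (Z (i + n))) = (n : ℝ)⁻¹ * dist (Z i) (Z (i + n)) := by
        conv_lhs => rw [← hf.center]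
        rw [hf.dist_map]
      rw [h2, inv_mul_eq_div, le_div_iff₀ hn'] at h1
      linarith
  have hdist : ∀ i j : ℤ, dist (Z i) (Z j) = |(i : ℝ) - j| * a := by
    intro i j
    rcases le_total i j with hij | hij
    · obtain ⟨n, rfl⟩ := Int.le.dest hij
      rw [hdist']
      push_cast
      rw [show (i : ℝ) - (i + n) = -n by ring, abs_neg, Nat.abs_cast]
    · obtain ⟨n, rfl⟩ := Int.le.dest hij
      rw [dist_comm, hdist']
      push_cast
      rw [show (j : ℝ) + n - j = n by ring, Nat.abs_cast]
  set T : ℕ → ℝ := fun n => 1 / ((n : ℝ) + 1) with hT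
  have hTpos : ∀ n, 0 < T n := fun n => by simp only [hT]; positivity
  have hT0 : Tendsto T (hyperfilter ℕ : Filter ℕ) (𝓝 0) := tendsto_hyperfilter_inv
  set k : ℝ → ℕ → ℤ := fun t n => ⌊t / (a * T n)⌋ with hk
  have hkle : ∀ t n, |a * T n * k t n - t| ≤ a * T n := by
    intro t n
    have hp : 0 < a * T n := mul_pos hapos (hTpos n)
    have h1 := Int.floor_le (t / (a * T n))
    have h2 := Int.lt_floor_add_one (t / (a * T n))
    rw [le_div_iff₀ hp] at h1
    rw [div_lt_iff₀ hp] at h2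
    rw [abs_le]
    constructor <;> simp only [hk] <;> linarith
  have hklim : ∀ t, Tendsto (fun n => a * T n * k t n) (hyperfilter ℕ : Filter ℕ) (𝓝 t) := by
    intro t
    rw [tendsto_iff_dist_tendsto_zero]
    refine squeeze_zero (fun n => dist_nonneg) (fun n => ?_) (by simpa using hT0.const_mul a)
    rw [Real.dist_eq]
    exact hkle t n
  choose f hf using fun n => hI.exists_homothety x (hTpos n)
  have hfd : ∀ s t n, dist (f n (Z (k s n))) (f n (Z (k t n))) =
      |a * T n * k s n - a * T n * k t n| := by
    intro s t n
    rw [(hf n).dist_map, hdist, ← mul_sub, abs_mul, abs_of_pos (mul_pos hapos (hTpos n))]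
    ring
  have hk0 : ∀ n, f n (Z (k 0 n)) = x := by
    intro n
    simp only [hk, zero_div, Int.floor_zero]
    rw [hZ0, (hf n).center]
  have hbd : ∀ t n, dist (f n (Z (k t n))) x ≤ |t| + a := by
    intro t n
    have h1 := hfd t 0 n
    rw [hk0] at h1
    rw [h1]
    have h2 := hkle t n
    have h3 : T n ≤ 1 := by
      simp only [hT]
      rw [div_le_one (by positivity)]
      have : (0 : ℝ) ≤ n := by positivity
      linarith
    have h4 : a * T n ≤ a * 1 := by gcongr
    have h5 : a * T n * (k 0 n : ℝ) = 0 := by simp [hk]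
    have h6 := abs_add_le (a * T n * k t n - t) t
    rw [sub_add_cancel] at h6
    rw [h5, sub_zero]
    linarith
  choose e he using fun t => exists_hyperfilter_lim (hbd t)
  refine ⟨e, isometry_of_dist fun s t => ?_, ?_, a, fun c hc => ?_⟩
  · refine tendsto_nhds_unique ((he s).dist (he t)) ?_
    simp only [hfd]
    exact ((hklim s).sub (hklim t)).abs
  · refine tendsto_nhds_unique (he 0) ?_
    simp only [hk0]
    exact tendsto_const_nhds
  · have h1 := ((continuous_bus hc).tendsto (e a)).comp (he a)
    have h2 : Tendsto (fun n => bus c x + (a * T n * k a n) / a * w c)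
        (hyperfilter ℕ : Filter ℕ) (𝓝 (bus c x + a / a * w c)) :=
      (((hklim a).div_const a).mul_const _).const_add _
    have h3 := tendsto_nhds_unique h1 (h2.congr fun n => ?_)
    · rw [h3, div_self hapos.ne', one_mul]
      simp only [hw]
      ring
    · simp only [Function.comp]
      rw [(hf n).bus_map hP hI hc (hTpos n), hbus _ c hc]
      field_simp
      ring

end MetricCore

section MobiusTopology

open Filter Topology Set

variable {X : Type*} {S : MobiusStructure X} {d : ExtMetric X} {ω : X}

theorem ExtMetric.eq_of_d_eq_zero (d : ExtMetric X) {x y : X} (h : d.d x y = 0) : x = y := by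
  by_contra hne
  exact (d.pos x y hne).ne' h

/-- The complement of the remote point `ω`, carrying the finite part of the extended metric. -/
def AffinePart (d : ExtMetric X) (ω : X) (_ : d.rem = some ω) : Type _ := {x : X // x ≠ ω}

theorem AffinePart.exists_val {hr : d.rem = some ω} {x : X} (hx : x ≠ ω) :
    ∃ q : AffinePart d ω hr, q.1 = x := ⟨⟨x, hx⟩, rfl⟩

theorem ExtMetric.d_ne_top (hr : d.rem = some ω) {x y : X} (hx : x ≠ ω) (hy : y ≠ ω) :
    d.d x y ≠ ⊤ := by
  intro h
  rcases (d.d_eq_top_iff x y).1 h with ⟨-, h | h⟩ <;> rw [hr, Option.some.injEq] at h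
  · exact hx h.symm
  · exact hy h.symm

theorem ExtMetric.d_rem (hr : d.rem = some ω) {x : X} (hx : x ≠ ω) : d.d x ω = ⊤ :=
  (d.d_eq_top_iff x ω).2 ⟨hx, Or.inr hr⟩

theorem ExtMetric.d_rem' (hr : d.rem = some ω) {x : X} (hx : x ≠ ω) : d.d ω x = ⊤ := by
  rw [d.symm, d.d_rem hr hx]

noncomputable instance (hr : d.rem = some ω) : MetricSpace (AffinePart d ω hr) where
  dist x y := (d.d x.1 y.1).toReal
  dist_self x := by simp [d.d_self]
  dist_comm x y := by rw [d.symm]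
  dist_triangle x y z := by
    rw [← ENNReal.toReal_add (d.d_ne_top hr x.2 y.2) (d.d_ne_top hr y.2 z.2)]
    exact ENNReal.toReal_mono
      (ENNReal.add_ne_top.2 ⟨d.d_ne_top hr x.2 y.2, d.d_ne_top hr y.2 z.2⟩) (d.triangle _ _ _)
  eq_of_dist_eq_zero {x y} h := by
    rcases (ENNReal.toReal_eq_zero_iff _).1 h with h | h
    · exact Subtype.ext (d.eq_of_d_eq_zero h)
    · exact absurd h (d.d_ne_top hr x.2 y.2)

theorem AffinePart.dist_def {hr : d.rem = some ω} (x y : AffinePart d ω hr) :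
    dist x y = (d.d x.1 y.1).toReal := rfl

theorem AffinePart.edist_def {hr : d.rem = some ω} (x y : AffinePart d ω hr) :
    edist x y = d.d x.1 y.1 := by
  rw [edist_dist, AffinePart.dist_def, ENNReal.ofReal_toReal (d.d_ne_top hr x.2 y.2)]

theorem AffinePart.fd_eq {hr : d.rem = some ω} (x y : AffinePart d ω hr) :
    d.fd x.1 y.1 = dist x y := by
  rw [ExtMetric.fd, if_neg (d.d_ne_top hr x.2 y.2), AffinePart.dist_def]

theorem admissible_of_ne {x y z u : X} (hxz : x ≠ z) (hyu : y ≠ u) : Admissible x y z u :=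
  ⟨fun h => hxz (h.1.trans h.2), fun h => hyu h.2, fun h => hxz h.1, fun h => hyu (h.1.trans h.2)⟩

theorem AffinePart.ptolemyIneq (hpt : IsPtolemyStructure S) (hd : d ∈ S.M)
    (hr : d.rem = some ω) : PtolemyIneq (AffinePart d ω hr) := by
  intro x y z u
  by_cases hxz : x = z
  · rw [hxz, dist_self, zero_mul]
    positivity
  by_cases hyu : y = u
  · rw [hyu, dist_self, mul_zero]
    positivity
  have hadm : Admissible x.1 y.1 z.1 u.1 :=
    admissible_of_ne (fun h => hxz (Subtype.ext h)) fun h => hyu (Subtype.ext h)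
  have := (hpt d hd _ _ _ _ hadm).2.1
  simpa only [crtVec, AffinePart.fd_eq] using this

variable [t : TopologicalSpace X]

theorem continuous_d (ht : t = mobiusTop S) (hd : d ∈ S.M) {x : X} (hx : d.rem ≠ some x) :
    Continuous fun y => d.d y x := by
  have hsub : ∀ r : ℝ≥0∞, 0 < r → r ≠ ⊤ → IsOpen {y | d.d y x < r} ∧ IsOpen {y | r < d.d y x} := by
    intro r h0 h1
    subst ht
    exact ⟨TopologicalSpace.isOpen_generateFrom_of_mem ⟨d, hd, x, hx, r, h0, h1, Or.inl rfl⟩,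
      TopologicalSpace.isOpen_generateFrom_of_mem ⟨d, hd, x, hx, r, h0, h1, Or.inr rfl⟩⟩
  rw [OrderTopology.topology_eq_generate_intervals (α := ℝ≥0∞), continuous_generateFrom_iff]
  rintro _ ⟨a, rfl | rfl⟩
  · rw [isOpen_iff_forall_mem_open]
    intro y hy
    obtain ⟨r, h1, h2⟩ := exists_between (show a < d.d y x from hy)
    exact ⟨_, fun z hz => h1.trans (show r < d.d z x from hz),
      (hsub r (bot_le.trans_lt h1) (ne_top_of_lt h2)).2, h2⟩
  · rw [isOpen_iff_forall_mem_open]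
    intro y hy
    obtain ⟨r, h1, h2⟩ := exists_between (show d.d y x < a from hy)
    exact ⟨_, fun z hz => (show d.d z x < r from hz).trans h2,
      (hsub r (bot_le.trans_lt h1) (ne_top_of_lt h2)).1, h1⟩

theorem t2Space_mobiusTop (ht : t = mobiusTop S) : T2Space X := by
  obtain ⟨d, hd⟩ := S.nonempty
  refine ⟨fun x y hxy => ?_⟩
  by_cases hx : d.rem = some x
  · have hy : d.rem ≠ some y := by rw [hx]; simpa using hxy
    exact separated_by_continuous (continuous_d ht hd hy)
      (by simpa [d.d_self] using (d.pos x y hxy).ne')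
  · exact separated_by_continuous (continuous_d ht hd hx)
      (by simpa [d.d_self] using (d.pos y x hxy.symm).ne)

theorem tendsto_of_tendsto_d (ht : t = mobiusTop S) [CompactSpace X] (hd : d ∈ S.M)
    (hr : d.rem = some ω) {ι : Type*} {l : Filter ι} {u : ι → X} {p : X}
    (h : ∀ x, x ≠ ω → Tendsto (fun i => d.d (u i) x) l (𝓝 (d.d p x))) : Tendsto u l (𝓝 p) := by
  rw [tendsto_iff_ultrafilter]
  intro g hg
  obtain ⟨q, -, hq⟩ := isCompact_univ.ultrafilter_le_nhds (g.map u) (by simp)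
  have hq' : Tendsto u g (𝓝 q) := hq
  have key : ∀ x, x ≠ ω → d.d q x = d.d p x := fun x hx =>
    tendsto_nhds_unique
      (((continuous_d ht hd (by rw [hr]; simpa using hx.symm)).tendsto q).comp hq') ((h x hx).mono_left hg)
  obtain rfl : q = p := by
    by_cases hp : p = ω
    · by_contra hne
      have hqω : q ≠ ω := fun e => hne (e.trans hp.symm)
      have := key q hqω
      rw [d.d_self] at this
      exact hne (d.eq_of_d_eq_zero this.symm).symm
    · have := key p hp
      rw [d.d_self] at this
      exact d.eq_of_d_eq_zero this
  exact hq

theorem AffinePart.tendsto_of_val (ht : t = mobiusTop S) (hd : d ∈ S.M) {hr : d.rem = some ω}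
    {ι : Type*} {l : Filter ι} {u : ι → AffinePart d ω hr} {p : AffinePart d ω hr}
    (h : Tendsto (fun i => (u i).1) l (𝓝 p.1)) : Tendsto u l (𝓝 p) := by
  rw [tendsto_iff_edist_tendsto_0]
  have h1 := ((continuous_d ht hd (x := p.1) (by rw [hr]; simpa using p.2.symm)).tendsto p.1).comp h
  rw [d.d_self] at h1
  simpa only [AffinePart.edist_def] using! h1

theorem AffinePart.continuous_val (ht : t = mobiusTop S) [CompactSpace X] (hd : d ∈ S.M)
    {hr : d.rem = some ω} :
    Continuous (fun x : AffinePart d ω hr => x.1) := by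
  rw [continuous_iff_continuousAt]
  intro p
  refine tendsto_of_tendsto_d ht hd hr fun x hx => ?_
  obtain ⟨q, rfl⟩ := AffinePart.exists_val (hr := hr) hx
  have : Tendsto (fun y => edist y q) (𝓝 p) (𝓝 (edist p q)) :=
    (continuous_id.edist continuous_const).tendsto p
  simpa only [AffinePart.edist_def] using this

theorem AffinePart.properSpace (ht : t = mobiusTop S) [CompactSpace X] (hd : d ∈ S.M)
    (hr : d.rem = some ω) :
    ProperSpace (AffinePart d ω hr) := by
  refine ⟨fun o R => isCompact_iff_ultrafilter_le_nhds.2 fun g hg => ?_⟩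
  rw [le_principal_iff] at hg
  obtain ⟨p, -, hp⟩ := isCompact_univ.ultrafilter_le_nhds
    (g.map (fun x : AffinePart d ω hr => x.1)) (by simp)
  have hp' : Tendsto (fun x : AffinePart d ω hr => x.1) g (𝓝 p) := hp
  have h1 := ((continuous_d ht hd (x := o.1) (by rw [hr]; simpa using o.2.symm)).tendsto p).comp hp'
  have h2 : d.d p o.1 ≤ ENNReal.ofReal R := by
    refine le_of_tendsto h1 ?_
    filter_upwards [hg] with x hx
    change d.d x.1 o.1 ≤ _
    rw [← AffinePart.edist_def, edist_dist]
    exact ENNReal.ofReal_le_ofReal hx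
  have hpω : p ≠ ω := by
    rintro rfl
    rw [d.d_rem' hr o.2] at h2
    exact ENNReal.ofReal_ne_top (top_le_iff.1 h2)
  have h3 : Tendsto (fun x : AffinePart d ω hr => x) g (𝓝 ⟨p, hpω⟩) :=
    AffinePart.tendsto_of_val ht hd hp'
  refine ⟨⟨p, hpω⟩, ?_, h3⟩
  exact Metric.isClosed_closedBall.mem_of_tendsto h3 hg

/-- A family leaving every bounded set converges to the remote point. -/
theorem AffinePart.tendsto_rem (ht : t = mobiusTop S) [CompactSpace X] (hd : d ∈ S.M)
    {hr : d.rem = some ω} {ι : Type*} {l : Filter ι} {u : ι → AffinePart d ω hr}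
    (h : ∀ x, Tendsto (fun i => dist (u i) x) l atTop) :
    Tendsto (fun i => (u i).1) l (𝓝 ω) := by
  refine tendsto_of_tendsto_d ht hd hr fun x hx => ?_
  rw [d.d_rem' hr hx]
  obtain ⟨q, rfl⟩ := AffinePart.exists_val (hr := hr) hx
  have := ENNReal.tendsto_ofReal_atTop.comp (h q)
  simpa only [Function.comp_def, ← edist_dist, AffinePart.edist_def] using this

end MobiusTopology

section MobiusAlgebra

open Set

variable {X : Type*} {S : MobiusStructure X} {d d' : ExtMetric X} {ω : X}

theorem ExtMetric.fd_symm (d : ExtMetric X) (x y : X) : d.fd x y = d.fd y x := by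
  rw [ExtMetric.fd, ExtMetric.fd, d.symm]

theorem ExtMetric.fd_rem (hr : d.rem = some ω) {x : X} (hx : x ≠ ω) : d.fd x ω = 1 :=
  if_pos (d.d_rem hr hx)

theorem ExtMetric.fd_rem' (hr : d.rem = some ω) {x : X} (hx : x ≠ ω) : d.fd ω x = 1 :=
  if_pos (d.d_rem' hr hx)

theorem ExtMetric.d_ne_top_of_rem_ne {x y : X} (hx : d.rem ≠ some x) (hy : d.rem ≠ some y) :
    d.d x y ≠ ⊤ := fun h => ((d.d_eq_top_iff x y).1 h).2.elim hx hy

theorem ExtMetric.d_eq_ofReal_fd {x y : X} (hx : d.rem ≠ some x) (hy : d.rem ≠ some y) :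
    d.d x y = ENNReal.ofReal (d.fd x y) := by
  have h := d.d_ne_top_of_rem_ne hx hy
  rw [ExtMetric.fd, if_neg h, ENNReal.ofReal_toReal h]

theorem ExtMetric.fd_nonneg (d : ExtMetric X) (x y : X) : 0 ≤ d.fd x y := by
  unfold ExtMetric.fd
  split_ifs <;> simp

/-- The Ptolemy equality with diagonals `xz` and `yu`, expressed through the finite factors. -/
def PtolemyEq (d : ExtMetric X) (x y z u : X) : Prop :=
  d.fd x z * d.fd y u = d.fd x y * d.fd z u + d.fd x u * d.fd y z

theorem PtolemyEq.transfer (hd : d ∈ S.M) (hd' : d' ∈ S.M) {x y z u : X} (hxz : x ≠ z)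
    (hyu : y ≠ u) (h : PtolemyEq d x y z u) : PtolemyEq d' x y z u := by
  obtain ⟨l, -, hl⟩ := S.compat d hd d' hd' x y z u (admissible_of_ne hxz hyu)
  simp only [crtVec, Prod.smul_mk, smul_eq_mul, Prod.mk.injEq] at hl
  obtain ⟨h1, h2, h3⟩ := hl
  unfold PtolemyEq at h ⊢
  rw [h1, h2, h3, h]
  ring

theorem PtolemyEq.d_eq {x y z u : X} (hxy : x ≠ y) (hxz : x ≠ z)
    (hyu : y ≠ u) (hzu : z ≠ u) (h : PtolemyEq d x y z u) :
    d.d x z * d.d y u = d.d x y * d.d z u + d.d x u * d.d y z := by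
  have top : ∀ {a b c e : X}, a ≠ b → c ≠ e → (d.d a b = ⊤ ∨ d.d c e = ⊤) →
      d.d a b * d.d c e = ⊤ := by
    rintro a b c e hab hce (h | h) <;> rw [h]
    · exact ENNReal.top_mul (d.pos _ _ hce).ne'
    · exact ENNReal.mul_top (d.pos _ _ hab).ne'
  have htop : ∀ {a b : X}, a ≠ b → (d.rem = some a ∨ d.rem = some b) → d.d a b = ⊤ :=
    fun hab h => (d.d_eq_top_iff _ _).2 ⟨hab, h⟩
  by_cases hx : d.rem = some x
  · rw [top hxz hyu (Or.inl (htop hxz (Or.inl hx))), top hxy hzu (Or.inl (htop hxy (Or.inl hx))),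
      top_add]
  by_cases hy : d.rem = some y
  · rw [top hxz hyu (Or.inr (htop hyu (Or.inl hy))), top hxy hzu (Or.inl (htop hxy (Or.inr hy))),
      top_add]
  by_cases hz : d.rem = some z
  · rw [top hxz hyu (Or.inl (htop hxz (Or.inr hz))), top hxy hzu (Or.inr (htop hzu (Or.inl hz))),
      top_add]
  by_cases hu : d.rem = some u
  · rw [top hxz hyu (Or.inr (htop hyu (Or.inr hu))), top hxy hzu (Or.inr (htop hzu (Or.inr hu))),
      top_add]
  have n := d.fd_nonneg
  rw [d.d_eq_ofReal_fd hx hz, d.d_eq_ofReal_fd hy hu, d.d_eq_ofReal_fd hx hy,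
    d.d_eq_ofReal_fd hz hu, d.d_eq_ofReal_fd hx hu, d.d_eq_ofReal_fd hy hz,
    ← ENNReal.ofReal_mul (n _ _), ← ENNReal.ofReal_mul (n _ _), ← ENNReal.ofReal_mul (n _ _),
    ← ENNReal.ofReal_add (mul_nonneg (n _ _) (n _ _)) (mul_nonneg (n _ _) (n _ _)), h]

theorem ptolemyEq_of_d_eq {x y z u : X} (hx : d.rem ≠ some x) (hy : d.rem ≠ some y)
    (hz : d.rem ≠ some z) (hu : d.rem ≠ some u)
    (h : d.d x z * d.d y u = d.d x y * d.d z u + d.d x u * d.d y z) : PtolemyEq d x y z u := by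
  have n := d.fd_nonneg
  rw [d.d_eq_ofReal_fd hx hz, d.d_eq_ofReal_fd hy hu, d.d_eq_ofReal_fd hx hy,
    d.d_eq_ofReal_fd hz hu, d.d_eq_ofReal_fd hx hu, d.d_eq_ofReal_fd hy hz,
    ← ENNReal.ofReal_mul (n _ _), ← ENNReal.ofReal_mul (n _ _), ← ENNReal.ofReal_mul (n _ _),
    ← ENNReal.ofReal_add (mul_nonneg (n _ _) (n _ _)) (mul_nonneg (n _ _) (n _ _)),
    ENNReal.ofReal_eq_ofReal_iff (mul_nonneg (n _ _) (n _ _))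
      (add_nonneg (mul_nonneg (n _ _) (n _ _)) (mul_nonneg (n _ _) (n _ _)))] at h
  exact h

/-- The pullback of an extended metric by an involution. -/
def ExtMetric.pull (d : ExtMetric X) (φ : X → X) (hφ : Function.Involutive φ) : ExtMetric X where
  d x y := d.d (φ x) (φ y)
  rem := d.rem.map φ
  symm x y := d.symm _ _
  d_self x := d.d_self _
  pos x y h := d.pos _ _ (hφ.injective.ne h)
  triangle x y z := d.triangle _ _ _
  d_eq_top_iff x y := by
    have key : ∀ z, d.rem.map φ = some z ↔ d.rem = some (φ z) := by
      intro z
      rw [Option.map_eq_some_iff]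
      constructor
      · rintro ⟨a, ha, rfl⟩
        rw [hφ a, ha]
      · exact fun h => ⟨φ z, h, hφ z⟩
    rw [d.d_eq_top_iff, hφ.injective.ne_iff, key, key]

theorem ExtMetric.pull_mem (hd : d ∈ S.M) {φ : X → X} (hφ : Function.Involutive φ)
    (h : IsMobiusAuto S φ) : d.pull φ hφ ∈ S.M := by
  refine S.maximal _ fun d₁ hd₁ x y z u ha => ?_
  exact (S.compat d hd d₁ hd₁ x y z u ha).trans' (h.2 d hd x y z u ha)

theorem exists_spaceInversion (hI : PropertyI S) (hd : d ∈ S.M) (hr : d.rem = some ω) {o : X}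
    (ho : o ≠ ω) {r : ℝ≥0∞} (h0 : 0 < r) (h1 : r ≠ ⊤) :
    ∃ φ, IsSpaceInversion S o ω {x | d.d x o = r} φ :=
  (hI o ω ho _ ⟨d, hd, hr, r, h0, h1, rfl⟩).exists

theorem exists_metric_rem (hI : PropertyI S) (hd : d ∈ S.M) (hr : d.rem = some ω) (o : X) :
    ∃ d' ∈ S.M, d'.rem = some o := by
  by_cases ho : o = ω
  · exact ⟨d, hd, by rw [hr, ho]⟩
  · obtain ⟨φ, h1, h2, -, h4, -⟩ := exists_spaceInversion hI hd hr ho one_pos ENNReal.one_ne_top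
    refine ⟨d.pull φ h2, ExtMetric.pull_mem hd h2 h1, ?_⟩
    change d.rem.map φ = _
    rw [hr, Option.map_some, ← h4, h2 o]

end MobiusAlgebra

section Circles

open Filter Topology Set

theorem exists_onePoint_homeo (v : Metric.sphere (0 : ℂ) 1) :
    ∃ h : OnePoint ℝ ≃ₜ Metric.sphere (0 : ℂ) 1, h OnePoint.infty = v := by
  have hv : ‖(v : ℂ)‖ = 1 := by simp
  have hv0 : (v : ℂ) ≠ 0 := fun h => by simp [h] at hv
  have : Fact (Module.finrank ℝ ℂ = 1 + 1) := ⟨by simp [Complex.finrank_real_complex]⟩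
  have hfin : Module.finrank ℝ ℝ = Module.finrank ℝ ((Submodule.span ℝ {(v : ℂ)})ᗮ) := by
    rw [Submodule.finrank_orthogonal_span_singleton (n := 1) hv0, Module.finrank_self]
  obtain ⟨e⟩ := FiniteDimensional.nonempty_continuousLinearEquiv_of_finrank_eq hfin
  refine ⟨e.toHomeomorph.onePointCongr.trans (onePointHyperplaneHomeoUnitSphere hv), ?_⟩
  rfl

theorem isPreconnected_insert_infty {s : Set ℝ} (hs : IsPreconnected s) {l : Filter ℝ} [l.NeBot]
    (hl : l ≤ cocompact ℝ) (hsl : s ∈ l) :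
    IsPreconnected (insert OnePoint.infty ((fun t : ℝ => (t : OnePoint ℝ)) '' s)) := by
  refine (hs.image _ OnePoint.continuous_coe.continuousOn).subset_closure (subset_insert _ _)
    (insert_subset ?_ subset_closure)
  have h1 : Tendsto (fun t : ℝ => (t : OnePoint ℝ)) l (𝓝 OnePoint.infty) :=
    OnePoint.tendsto_coe_infty.mono_left (by rwa [coclosedCompact_eq_cocompact])
  exact mem_closure_of_tendsto h1 (mem_of_superset hsl fun t ht => mem_image_of_mem _ ht)

theorem abs_sub_eq_add_of_mem_uIcc {b b' m : ℝ} (h : m ∈ uIcc b b') :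
    |b - b'| = |b - m| + |m - b'| := by
  rcases mem_uIcc.1 h with ⟨h1, h2⟩ | ⟨h1, h2⟩
  · rw [abs_of_nonpos (by linarith), abs_of_nonpos (by linarith), abs_of_nonpos (by linarith)]
    ring
  · rw [abs_of_nonneg (by linarith), abs_of_nonneg (by linarith), abs_of_nonneg (by linarith)]
    ring

/-- Ptolemy equality on the real line for `a < b < a' < b'`. -/
theorem abs_ptolemy_of_le {a b a' b' : ℝ} (h1 : a ≤ b) (h2 : b ≤ a') (h3 : a' ≤ b') :
    |a - a'| * |b - b'| = |a - b| * |a' - b'| + |a - b'| * |b - a'| := by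
  rw [abs_of_nonpos (by linarith : a - a' ≤ 0), abs_of_nonpos (by linarith : b - b' ≤ 0),
    abs_of_nonpos (by linarith : a - b ≤ 0), abs_of_nonpos (by linarith : a' - b' ≤ 0),
    abs_of_nonpos (by linarith : a - b' ≤ 0), abs_of_nonpos (by linarith : b - a' ≤ 0)]
  ring

theorem abs_ptolemy_of_mem {a b a' b' : ℝ} (hb : b ≤ b') (h1 : a ∈ Icc b b')
    (h2 : a ≤ b ∨ b' ≤ a ∨ a' ≤ b ∨ b' ≤ a') :
    |a - a'| * |b - b'| = |a - b| * |a' - b'| + |a - b'| * |b - a'| := by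
  rcases h2 with h | h | h | h
  · obtain rfl : a = b := le_antisymm h h1.1
    simp [mul_comm]
  · obtain rfl : a = b' := le_antisymm h1.2 h
    simp only [sub_self, abs_zero, zero_mul, add_zero]
    rw [abs_sub_comm a' a, abs_sub_comm b a, mul_comm]
  · have := abs_ptolemy_of_le h h1.1 h1.2
    rw [abs_sub_comm a a', abs_sub_comm a b, abs_sub_comm b a', this]
    ring
  · have := abs_ptolemy_of_le h1.1 h1.2 h
    rw [abs_sub_comm a b, abs_sub_comm a' b']
    linarith

theorem abs_ptolemy {a b a' b' : ℝ} (h1 : a ∈ uIcc b b' ∨ a' ∈ uIcc b b')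
    (h2 : (a ≤ min b b' ∨ max b b' ≤ a) ∨ (a' ≤ min b b' ∨ max b b' ≤ a')) :
    |a - a'| * |b - b'| = |a - b| * |a' - b'| + |a - b'| * |b - a'| := by
  wlog hb : b ≤ b' generalizing b b'
  · have := @this b' b (by rwa [uIcc_comm]) (by rwa [min_comm, max_comm]) (le_of_not_ge hb)
    rw [abs_sub_comm b b', this, abs_sub_comm b' a', abs_sub_comm b a']
    ring
  wlog ha : a ∈ uIcc b b' generalizing a a'
  · have := @this a' a h1.symm h2.symm (h1.resolve_left ha)
    rw [abs_sub_comm a a', this, abs_sub_comm a' b', abs_sub_comm b a, abs_sub_comm a' b]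
    ring
  rw [uIcc_of_le hb] at ha
  rw [min_eq_left hb, max_eq_right hb, or_assoc] at h2
  exact abs_ptolemy_of_mem hb ha h2

variable {X : Type*} {S : MobiusStructure X} {d : ExtMetric X} {ω : X} [t : TopologicalSpace X]

theorem separatesIn_iff (ht : t = mobiusTop S) {σ : Set X} {x y z u : X} :
    SeparatesIn S σ x z y u ↔ u ∉ connectedComponentIn (σ \ {x, z}) y := by
  subst ht
  rfl

/-- Points lying on a connected arc are not separated by points off that arc. -/
theorem SeparatesIn.mem_of_isPreconnected (ht : t = mobiusTop S) {G : OnePoint ℝ → X}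
    (hG : Continuous G) (hinj : Function.Injective G) {p q r s : OnePoint ℝ}
    (h : SeparatesIn S (range G) (G p) (G r) (G q) (G s)) {K : Set (OnePoint ℝ)}
    (hK : IsPreconnected K) (hq : q ∈ K) (hs : s ∈ K) : p ∈ K ∨ r ∈ K := by
  rw [separatesIn_iff ht] at h
  by_contra! hn
  refine h ((hK.image G hG.continuousOn).subset_connectedComponentIn (mem_image_of_mem G hq) ?_
    (mem_image_of_mem G hs))
  rintro _ ⟨k, hk, rfl⟩
  refine ⟨mem_range_self k, ?_⟩
  rintro (h | h)
  · exact hn.1 (hinj h ▸ hk)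
  · exact hn.2 (hinj h ▸ hk)

theorem ptolemyEq_of_separatesIn (ht : t = mobiusTop S) {G : OnePoint ℝ → X}
    (hG : Continuous G) (hinj : Function.Injective G)
    (h1 : ∀ a b : ℝ, d.fd (G a) (G b) = |a - b|)
    (h2 : ∀ a : ℝ, d.fd (G a) (G OnePoint.infty) = 1) {p q r s : OnePoint ℝ}
    (hpq : p ≠ q) (hpr : p ≠ r) (hps : p ≠ s) (hqr : q ≠ r) (hqs : q ≠ s) (hrs : r ≠ s)
    (h : SeparatesIn S (range G) (G p) (G r) (G q) (G s)) :
    PtolemyEq d (G p) (G q) (G r) (G s) := by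
  have h2' : ∀ a : ℝ, d.fd (G OnePoint.infty) (G a) = 1 := fun a => by rw [d.fd_symm, h2]
  have key := fun {K} => h.mem_of_isPreconnected ht hG hinj (K := K)
  have kI : ∀ b b' : ℝ, IsPreconnected ((fun t : ℝ => (t : OnePoint ℝ)) '' uIcc b b') :=
    fun b b' => isPreconnected_uIcc.image _ OnePoint.continuous_coe.continuousOn
  have kT : ∀ b : ℝ, IsPreconnected
      (insert OnePoint.infty ((fun t : ℝ => (t : OnePoint ℝ)) '' Ici b)) :=
    fun b => isPreconnected_insert_infty isPreconnected_Ici atTop_le_cocompact (Ici_mem_atTop b)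
  have kB : ∀ b : ℝ, IsPreconnected
      (insert OnePoint.infty ((fun t : ℝ => (t : OnePoint ℝ)) '' Iic b)) :=
    fun b => isPreconnected_insert_infty isPreconnected_Iic atBot_le_cocompact (Iic_mem_atBot b)
  have kU : ∀ b b' : ℝ, IsPreconnected
      (insert OnePoint.infty ((fun t : ℝ => (t : OnePoint ℝ)) '' Iic b) ∪
        insert OnePoint.infty ((fun t : ℝ => (t : OnePoint ℝ)) '' Ici b')) :=
    fun b b' => (kB b).union OnePoint.infty (mem_insert _ _) (mem_insert _ _) (kT b')
  unfold PtolemyEq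
  induction p using OnePoint.rec with
  | infty =>
    induction q using OnePoint.rec with
    | infty => exact absurd rfl hpq
    | coe b =>
    induction r using OnePoint.rec with
    | infty => exact absurd rfl hpr
    | coe a' =>
    induction s using OnePoint.rec with
    | infty => exact absurd rfl hps
    | coe b' =>
      have := key (kI b b') (by simp) (by simp)
      simp only [mem_image, OnePoint.coe_ne_infty, and_false, exists_false, false_or,
        OnePoint.coe_eq_coe, exists_eq_right] at this
      rw [h1, h1, h1, h2', h2', h2', abs_sub_eq_add_of_mem_uIcc this]
      ring
  | coe a =>
    induction r using OnePoint.rec with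
    | infty =>
      induction q using OnePoint.rec with
      | infty => exact absurd rfl hqr
      | coe b =>
      induction s using OnePoint.rec with
      | infty => exact absurd rfl hrs
      | coe b' =>
        have := key (kI b b') (by simp) (by simp)
        simp only [mem_image, OnePoint.coe_ne_infty, and_false, exists_false, or_false,
          OnePoint.coe_eq_coe, exists_eq_right] at this
        rw [h1, h1, h1, h2, h2, h2', abs_sub_eq_add_of_mem_uIcc this, abs_sub_comm b a]
        ring
    | coe a' =>
    induction q using OnePoint.rec with
    | infty =>
      induction s using OnePoint.rec with
      | infty => exact absurd rfl hqs
      | coe b' =>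
        have e1 := key (kT b') (by simp) (by simp)
        have e2 := key (kB b') (by simp) (by simp)
        simp only [mem_insert_iff, OnePoint.coe_ne_infty, false_or, mem_image, mem_Ici, mem_Iic,
          OnePoint.coe_eq_coe, exists_eq_right] at e1 e2
        have : b' ∈ uIcc a a' := by
          rw [mem_uIcc]
          grind
        rw [h1, h1, h1, h2, h2', h2', abs_sub_eq_add_of_mem_uIcc this, abs_sub_comm a' b']
        ring
    | coe b =>
    induction s using OnePoint.rec with
    | infty =>
      have e1 := key (kT b) (by simp) (by simp)
      have e2 := key (kB b) (by simp) (by simp)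
      simp only [mem_insert_iff, OnePoint.coe_ne_infty, false_or, mem_image, mem_Ici, mem_Iic,
        OnePoint.coe_eq_coe, exists_eq_right] at e1 e2
      have : b ∈ uIcc a a' := by
        rw [mem_uIcc]
        grind
      rw [h1, h1, h1, h2, h2, h2, abs_sub_eq_add_of_mem_uIcc this]
      ring
    | coe b' =>
      have e1 := key (kI b b') (by simp) (by simp)
      have e2 := key (kU (min b b') (max b b'))
        (by rcases le_total b b' with h | h <;> simp [h])
        (by rcases le_total b b' with h | h <;> simp [h])
      simp only [mem_union, mem_insert_iff, OnePoint.coe_ne_infty, false_or, mem_image, mem_Ici,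
        mem_Iic, OnePoint.coe_eq_coe, exists_eq_right] at e1 e2
      rw [h1, h1, h1, h1, h1, h1]
      exact abs_ptolemy e1 e2

theorem separatesIn_infty (ht : t = mobiusTop S) {G : OnePoint ℝ → X}
    (hG : Continuous G) (hinj : Function.Injective G) {a b c : ℝ} (hab : a < b) (hbc : b < c) :
    SeparatesIn S (range G) (G a) (G c) (G b) (G OnePoint.infty) := by
  have hT2 : T2Space X := t2Space_mobiusTop ht
  rw [separatesIn_iff ht]
  intro hmem
  set C := connectedComponentIn (range G \ {G a, G c}) (G b) with hC
  have hsub : C ⊆ range G \ {G a, G c} := connectedComponentIn_subset _ _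
  let A : Set (OnePoint ℝ) := (fun t : ℝ => (t : OnePoint ℝ)) '' Icc a c
  let B : Set (OnePoint ℝ) := ((fun t : ℝ => (t : OnePoint ℝ)) '' Ioo a c)ᶜ
  have hA : IsClosed (G '' A) :=
    ((isCompact_Icc.image OnePoint.continuous_coe).image hG).isClosed
  have hB : IsClosed (G '' B) :=
    ((OnePoint.isOpen_image_coe.2 isOpen_Ioo).isClosed_compl.isCompact.image hG).isClosed
  have hcov : C ⊆ G '' A ∪ G '' B := by
    intro x hx
    obtain ⟨k, rfl⟩ := (hsub hx).1
    by_cases hk : k ∈ A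
    · exact Or.inl ⟨k, hk, rfl⟩
    · refine Or.inr ⟨k, fun hk' => hk ?_, rfl⟩
      exact image_mono Ioo_subset_Icc_self hk'
  have hb : G b ∈ C := mem_connectedComponentIn (connectedComponentIn_nonempty_iff.1 ⟨_, hmem⟩)
  obtain ⟨x, hx, ⟨k, hk, rfl⟩, k', hk', hkk⟩ := isPreconnected_closed_iff.1
    isPreconnected_connectedComponentIn _ _ hA hB hcov
    ⟨_, hb, b, ⟨b, ⟨hab.le, hbc.le⟩, rfl⟩, rfl⟩
    ⟨_, hmem, OnePoint.infty, by simp [B], rfl⟩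
  obtain rfl := hinj hkk
  obtain ⟨s, hs, rfl⟩ := hk
  have hs' : s ∉ Ioo a c := fun h => hk' ⟨s, h, rfl⟩
  refine (hsub hx).2 ?_
  by_cases hsa : s = a
  · exact Or.inl (by rw [hsa])
  · refine Or.inr ?_
    have : s = c := by
      by_contra hsc
      exact hs' ⟨lt_of_le_of_ne hs.1 (Ne.symm hsa), lt_of_le_of_ne hs.2 hsc⟩
    simp [this]

end Circles

section Lines

open Filter Topology Set

variable {X : Type*} {S : MobiusStructure X} {d : ExtMetric X} {ω : X} [t : TopologicalSpace X]

theorem homeoToCircle_iff (ht : t = mobiusTop S) {σ : Set X} :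
    HomeoToCircle S σ ↔ Nonempty (σ ≃ₜ Metric.sphere (0 : ℂ) 1) := by
  subst ht
  rfl

theorem exists_onePoint_param (ht : t = mobiusTop S) {σ : Set X} (h : HomeoToCircle S σ)
    (hω : ω ∈ σ) : ∃ G : OnePoint ℝ → X, Continuous G ∧ Function.Injective G ∧
      G OnePoint.infty = ω ∧ range G = σ := by
  rw [homeoToCircle_iff ht] at h
  obtain ⟨h⟩ := h
  obtain ⟨g, hg⟩ := exists_onePoint_homeo (h ⟨ω, hω⟩)
  refine ⟨fun p => (h.symm (g p)).1, by fun_prop,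
    Subtype.val_injective.comp (h.symm.injective.comp g.injective), by simp [hg], ?_⟩
  ext x
  constructor
  · rintro ⟨p, rfl⟩
    exact (h.symm (g p)).2
  · exact fun hx => ⟨g.symm (h ⟨x, hx⟩), by simp⟩

theorem homeoToCircle_range (ht : t = mobiusTop S) [CompactSpace X] {G : OnePoint ℝ → X}
    (hG : Continuous G) (hinj : Function.Injective G) : HomeoToCircle S (range G) := by
  have hT2 : T2Space X := t2Space_mobiusTop ht
  obtain ⟨g, -⟩ := exists_onePoint_homeo ⟨1, by simp⟩
  exact (homeoToCircle_iff ht).2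
    ⟨(hG.isClosedEmbedding hinj).isEmbedding.toHomeomorph.symm.trans g⟩

theorem isPtolemyCircle_of_isometry (ht : t = mobiusTop S) [CompactSpace X] (hd : d ∈ S.M)
    {hr : d.rem = some ω} {c : ℝ → AffinePart d ω hr} (hc : Isometry c) :
    IsPtolemyCircle S (insert ω (range fun t => (c t).1)) := by
  let G : OnePoint ℝ → X := fun p => p.elim ω fun t => (c t).1
  have hrange : insert ω (range fun t => (c t).1) = range G := by
    ext x
    constructor
    · rintro (rfl | ⟨t, rfl⟩)
      · exact ⟨OnePoint.infty, rfl⟩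
      · exact ⟨(t : OnePoint ℝ), rfl⟩
    · rintro ⟨p, rfl⟩
      induction p using OnePoint.rec with
      | infty => exact Or.inl rfl
      | coe t => exact Or.inr ⟨t, rfl⟩
  have hG : Continuous G := by
    rw [OnePoint.continuous_iff]
    refine ⟨?_, (AffinePart.continuous_val ht hd).comp hc.continuous⟩
    rw [coclosedCompact_eq_cocompact]
    refine AffinePart.tendsto_rem ht hd fun x => ?_
    refine tendsto_atTop_mono (f := fun s : ℝ => ‖s‖ - dist x (c 0)) (fun s => ?_)
      (tendsto_atTop_add_const_right _ _ tendsto_norm_cocompact_atTop)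
    have h1 := dist_triangle (c s) x (c 0)
    rw [isometry_dist hc, sub_zero] at h1
    rw [Real.norm_eq_abs]
    linarith
  have hinj : Function.Injective G := by
    intro p q hpq
    induction p using OnePoint.rec with
    | infty =>
      induction q using OnePoint.rec with
      | infty => rfl
      | coe b => exact absurd hpq.symm (c b).2
    | coe a =>
      induction q using OnePoint.rec with
      | infty => exact absurd hpq (c a).2
      | coe b => rw [hc.injective (Subtype.ext hpq)]
  rw [hrange]
  refine ⟨homeoToCircle_range ht hG hinj, ?_⟩
  rintro d' hd' _ ⟨p, rfl⟩ _ ⟨q, rfl⟩ _ ⟨r, rfl⟩ _ ⟨s, rfl⟩ hpq hpr hps hqr hqs hrs hsep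
  have := ptolemyEq_of_separatesIn (d := d) ht hG hinj
    (fun a b => (AffinePart.fd_eq (c a) (c b)).trans (isometry_dist hc a b))
    (fun a => d.fd_rem hr (c a).2) (ne_of_apply_ne _ hpq) (ne_of_apply_ne _ hpr)
    (ne_of_apply_ne _ hps) (ne_of_apply_ne _ hqr) (ne_of_apply_ne _ hqs) (ne_of_apply_ne _ hrs) hsep
  exact (this.transfer hd hd' hpr hqs).d_eq hpq hpr hqs hrs

theorem exists_isometry_of_isPtolemyCircle (ht : t = mobiusTop S) [CompactSpace X]
    (hI : PropertyI S) (hd : d ∈ S.M) (hr : d.rem = some ω) {σ : Set X}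
    (hσ : IsPtolemyCircle S σ) (hω : ω ∈ σ) :
    ∃ c : ℝ → AffinePart d ω hr, Isometry c ∧ (range fun t => (c t).1) = σ \ {ω} := by
  obtain ⟨G, hG, hinj, hGω, rfl⟩ := exists_onePoint_param ht hσ.1 hω
  have hne : ∀ a : ℝ, G a ≠ ω := fun a h => OnePoint.coe_ne_infty a (hinj (h.trans hGω.symm))
  let e : ℝ → AffinePart d ω hr := fun a => ⟨G a, hne a⟩
  have he : Continuous e := continuous_iff_continuousAt.2 fun a =>
    AffinePart.tendsto_of_val ht hd ((hG.comp OnePoint.continuous_coe).tendsto a)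
  have hcoe : ∀ {a b : ℝ}, a ≠ b → G a ≠ G b := fun h =>
    hinj.ne (OnePoint.coe_injective.ne h)
  have einj : Function.Injective e := fun a b h => by
    by_contra hab
    exact hcoe hab (congrArg Subtype.val h)
  have hadd : ∀ {a b c : ℝ}, a < b → b < c →
      dist (e a) (e c) = dist (e a) (e b) + dist (e b) (e c) := by
    intro a b c hab hbc
    obtain ⟨d', hd', hr'⟩ := exists_metric_rem hI hd hr (G ((c + 1 : ℝ) : OnePoint ℝ))
    have h1 := hσ.2 d' hd' (G a) ⟨_, rfl⟩ (G b) ⟨_, rfl⟩ (G c) ⟨_, rfl⟩ ω hω (hcoe hab.ne)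
      (hcoe (hab.trans hbc).ne) (hne a) (hcoe hbc.ne) (hne b) (hne c)
      (hGω ▸ separatesIn_infty ht hG hinj hab hbc)
    have h2 := ptolemyEq_of_d_eq
      (by rw [hr', Ne, Option.some_inj]; exact hcoe (by linarith))
      (by rw [hr', Ne, Option.some_inj]; exact hcoe (by linarith))
      (by rw [hr', Ne, Option.some_inj]; exact hcoe (by linarith))
      (by rw [hr', Ne, Option.some_inj]; exact hne _) h1
    have h3 := h2.transfer hd' hd (hcoe (hab.trans hbc).ne) (hne b)
    unfold PtolemyEq at h3
    rw [d.fd_rem hr (hne a), d.fd_rem hr (hne b), d.fd_rem hr (hne c)] at h3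
    have e1 : d.fd (G a) (G b) = dist (e a) (e b) := AffinePart.fd_eq (e a) (e b)
    have e2 : d.fd (G a) (G c) = dist (e a) (e c) := AffinePart.fd_eq (e a) (e c)
    have e3 : d.fd (G b) (G c) = dist (e b) (e c) := AffinePart.fd_eq (e b) (e c)
    rw [e1, e2, e3] at h3
    linarith
  have hinf : Tendsto (fun a => dist (e a) (e 0)) (cocompact ℝ) atTop := by
    have h1 : Tendsto (fun a : ℝ => G a) (cocompact ℝ) (𝓝 ω) := by
      rw [← hGω, ← coclosedCompact_eq_cocompact]
      exact (hG.tendsto _).comp OnePoint.tendsto_coe_infty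
    have h2 := ((continuous_d ht hd (x := (e 0).1) (by rw [hr]; simpa using (e 0).2.symm)).tendsto
      ω).comp h1
    rw [d.d_rem' hr (e 0).2] at h2
    rw [tendsto_atTop]
    intro K
    filter_upwards [h2.eventually (lt_mem_nhds (ENNReal.ofReal_lt_top (r := K)))] with a ha
    have h3 : ENNReal.ofReal K < edist (e a) (e 0) := by
      rw [AffinePart.edist_def]
      exact ha
    rw [edist_dist] at h3
    exact (ENNReal.ofReal_lt_ofReal_iff'.1 h3).1.le
  let F : ℝ → ℝ := fun a => if 0 ≤ a then dist (e a) (e 0) else -dist (e a) (e 0)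
  have hF0 : F 0 = 0 := by simp [F]
  have hFpos : ∀ {a}, 0 < a → F a = dist (e 0) (e a) := fun {a} h => by
    simp only [F, if_pos h.le]
    exact dist_comm _ _
  have hFneg : ∀ {a}, a < 0 → F a = -dist (e a) (e 0) := fun {a} h => if_neg (not_le.2 h)
  have hFlt : ∀ {a b}, a < b → F b - F a = dist (e a) (e b) := by
    intro a b hab
    rcases lt_trichotomy a 0 with ha | rfl | ha
    · rcases lt_trichotomy b 0 with hb | rfl | hb
      · rw [hFneg ha, hFneg hb, hadd hab hb]; ring
      · rw [hFneg ha, hF0]; ring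
      · rw [hFneg ha, hFpos hb, hadd ha hb]; ring
    · rw [hFpos hab, hF0, sub_zero]
    · rw [hFpos ha, hFpos (ha.trans hab), hadd ha hab]; ring
  have hFabs : ∀ a b, dist (e a) (e b) = |F a - F b| := by
    intro a b
    rcases lt_trichotomy a b with h | rfl | h
    · rw [abs_sub_comm, hFlt h, abs_of_nonneg dist_nonneg]
    · simp
    · rw [hFlt h, abs_of_nonneg dist_nonneg, dist_comm]
  have hFcont : Continuous F := by
    rw [continuous_iff_continuousAt]
    intro a
    rw [ContinuousAt, tendsto_iff_dist_tendsto_zero]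
    simp only [Real.dist_eq, ← hFabs]
    exact tendsto_iff_dist_tendsto_zero.1 (he.tendsto a)
  have htop : Tendsto F atTop atTop := by
    refine (hinf.mono_left atTop_le_cocompact).congr' ?_
    filter_upwards [eventually_gt_atTop 0] with a ha
    rw [hFpos ha, dist_comm]
  have hbot : Tendsto F atBot atBot := by
    refine (tendsto_neg_atTop_atBot.comp (hinf.mono_left atBot_le_cocompact)).congr' ?_
    filter_upwards [eventually_lt_atBot 0] with a ha
    rw [hFneg ha, Function.comp]
  obtain ⟨g, hg⟩ := (hFcont.surjective htop hbot).hasRightInverse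
  have hgF : ∀ a, g (F a) = a := fun a => einj <| by
    rw [← dist_eq_zero, hFabs, hg, sub_self, abs_zero]
  refine ⟨fun s => e (g s), isometry_of_dist fun s t => by rw [hFabs, hg, hg], ?_⟩
  ext x
  constructor
  · rintro ⟨s, rfl⟩
    exact ⟨⟨_, rfl⟩, hne _⟩
  · rintro ⟨⟨p, rfl⟩, hx⟩
    induction p using OnePoint.rec with
    | infty => exact absurd hGω hx
    | coe a => exact ⟨F a, by simp only [hgF, e]⟩

end Lines

section Inversions

open Filter Topology Set

variable {X : Type*} {S : MobiusStructure X} {d : ExtMetric X} {ω : X}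

/-- The metric identities satisfied by a space inversion. -/
theorem IsSpaceInversion.exists_affine {hr : d.rem = some ω} (hd : d ∈ S.M)
    {o p : AffinePart d ω hr} {r : ℝ} (hr0 : 0 < r) (hp : dist p o = r) {φ : X → X}
    (h : IsSpaceInversion S o.1 ω {x | d.d x o.1 = ENNReal.ofReal r} φ) :
    ∃ ψ : AffinePart d ω hr → AffinePart d ω hr, (∀ x, x ≠ o → (ψ x).1 = φ x.1) ∧
      (∀ x, x ≠ o → ψ x ≠ o ∧ dist (ψ x) o * dist x o = r ^ 2) ∧
      ∀ x y, x ≠ o → y ≠ o →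
        dist (ψ x) (ψ y) * (dist x o * dist y o) = r ^ 2 * dist x y := by
  classical
  obtain ⟨h1, h2, -, h4, h5, -⟩ := h
  have h4' : φ ω = o.1 := (congrArg φ h4).symm.trans (h2 o.1)
  have hφ : ∀ x : AffinePart d ω hr, x ≠ o → φ x.1 ≠ ω := fun x hx h =>
    hx (Subtype.ext (h2.injective (h.trans h4.symm)))
  let ψ : AffinePart d ω hr → AffinePart d ω hr := fun x =>
    if hx : x = o then o else ⟨φ x.1, hφ x hx⟩
  have hψ : ∀ x, x ≠ o → (ψ x).1 = φ x.1 := fun x hx =>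
    congrArg Subtype.val (dif_neg hx)
  have hψo : ∀ x, x ≠ o → ψ x ≠ o := fun x hx h => by
    have := hψ x hx
    rw [h, ← h4'] at this
    exact x.2 (h2.injective this).symm
  have crt : ∀ x y, x ≠ o → y ≠ o → x ≠ y → ∃ l : ℝ, dist (ψ x) (ψ y) = l * dist x y ∧
      dist (ψ y) o = l * dist x o ∧ dist (ψ x) o = l * dist y o := by
    intro x y hx hy hxy
    obtain ⟨l, -, hl⟩ := h1.2 d hd x.1 y.1 o.1 ω
      (admissible_of_ne (fun h => hx (Subtype.ext h)) y.2)
    rw [← hψ x hx, ← hψ y hy, h4, h4'] at hl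
    simp only [crtVec, Prod.smul_mk, smul_eq_mul, Prod.mk.injEq, d.fd_rem hr x.2, d.fd_rem hr y.2,
      d.fd_rem hr (ψ x).2, d.fd_rem hr (ψ y).2, d.fd_rem hr o.2, d.fd_rem' hr o.2,
      AffinePart.fd_eq, mul_one, one_mul] at hl
    exact ⟨l, hl⟩
  have hsphere : ∀ x : AffinePart d ω hr, d.d x.1 o.1 = ENNReal.ofReal r ↔ dist x o = r := by
    intro x
    rw [← AffinePart.edist_def, edist_dist, ENNReal.ofReal_eq_ofReal_iff dist_nonneg hr0.le]
  have hpo : p ≠ o := fun h => by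
    rw [h, dist_self] at hp
    exact hr0.ne hp
  have hψp : dist (ψ p) o = r := by
    rw [← hsphere, hψ p hpo]
    have : φ p.1 ∈ φ '' {x | d.d x o.1 = ENNReal.ofReal r} := ⟨_, (hsphere p).2 hp, rfl⟩
    rwa [h5] at this
  have hK : ∀ x, x ≠ o → dist (ψ x) o * dist x o = r ^ 2 := by
    intro x hx
    by_cases hxp : x = p
    · rw [hxp, hψp, hp, sq]
    · obtain ⟨l, -, e2, e3⟩ := crt x p hx hpo hxp
      rw [hψp] at e2
      rw [hp] at e3
      rw [e3]
      linear_combination -r * e2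
  refine ⟨ψ, hψ, fun x hx => ⟨hψo x hx, hK x hx⟩, fun x y hx hy => ?_⟩
  by_cases hxy : x = y
  · simp [hxy]
  · obtain ⟨l, e1, e2, e3⟩ := crt x y hx hy hxy
    rw [e1, ← hK y hy, e2]
    ring

variable [t : TopologicalSpace X]

theorem exists_isometry (ht : t = mobiusTop S) [CompactSpace X] (hE : PropertyE S)
    (hI : PropertyI S) (hd : d ∈ S.M) (hr : d.rem = some ω) :
    ∃ c : ℝ → AffinePart d ω hr, Isometry c := by
  obtain ⟨σ, hσ⟩ := hE
  by_cases hω : ω ∈ σ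
  · obtain ⟨c, hc, -⟩ := exists_isometry_of_isPtolemyCircle ht hI hd hr hσ hω
    exact ⟨c, hc⟩
  obtain ⟨o, ho⟩ : ∃ o, o ∈ σ := by
    obtain ⟨h⟩ := (homeoToCircle_iff ht).1 hσ.1
    exact ⟨_, (h.symm ⟨1, by simp⟩).2⟩
  obtain ⟨φ, h1, h2, -, h4, -⟩ := exists_spaceInversion hI hd hr (o := o)
    (fun h => hω (h ▸ ho)) one_pos ENNReal.one_ne_top
  have hr' : (d.pull φ h2).rem = some o := by
    change d.rem.map φ = _
    rw [hr, Option.map_some, ← h4, h2 o]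
  obtain ⟨c, hc, -⟩ := exists_isometry_of_isPtolemyCircle ht hI (ExtMetric.pull_mem hd h2 h1) hr'
    hσ ho
  refine ⟨fun s => ⟨φ (c s).1, fun h => (c s).2 (h2.injective (h.trans h4.symm))⟩,
    isometry_of_dist fun s t => ?_⟩
  exact isometry_dist hc s t

theorem hasInversions (ht : t = mobiusTop S) [CompactSpace X] (hE : PropertyE S)
    (hI : PropertyI S) (hd : d ∈ S.M) (hr : d.rem = some ω) :
    HasInversions (AffinePart d ω hr) := by
  intro o
  obtain ⟨c, hc⟩ := exists_isometry ht hE hI hd hr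
  refine ⟨dist (c 0) o, fun r hr0 hr1 => ?_⟩
  obtain ⟨s, hs⟩ : r ∈ range fun s => dist (c s) o := by
    refine mem_range_of_exists_le_of_exists_ge (hc.continuous.dist continuous_const) ⟨0, hr1⟩
      ⟨r + dist (c 0) o, ?_⟩
    have h1 := dist_triangle_right (c (r + dist (c 0) o)) (c 0) o
    have h2 : (0 : ℝ) ≤ r + dist (c 0) o := by positivity
    rw [isometry_dist hc, sub_zero, abs_of_nonneg h2] at h1
    linarith
  obtain ⟨φ, hφ⟩ := exists_spaceInversion hI hd hr o.2 (ENNReal.ofReal_pos.2 hr0)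
    ENNReal.ofReal_ne_top
  obtain ⟨ψ, h0, h1, h2⟩ := hφ.exists_affine hd hr0 hs
  refine ⟨ψ, h1, h2, fun e he he0 a ha => ?_⟩
  have hno : ∀ {a}, a ≠ 0 → e a ≠ o := fun ha h => ha (he.injective (h.trans he0.symm))
  have hdist : ∀ a, dist (e a) o = |a| := fun a => by
    rw [← he0, isometry_dist he, sub_zero]
  have hmem : ∀ a, a ≠ 0 → ∃ b, ψ (e a) = e b ∧ |b| * |a| = r ^ 2 := by
    intro a ha
    have hσ := hφ.2.2.2.2.2 _ (isPtolemyCircle_of_isometry ht hd he)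
      (Or.inr ⟨0, congrArg Subtype.val he0⟩) (mem_insert _ _)
    have : φ (e a).1 ∈ insert ω (range fun t => (e t).1) := by
      rw [← hσ]
      exact mem_image_of_mem _ (Or.inr ⟨a, rfl⟩)
    rw [← h0 _ (hno ha)] at this
    rcases this with h | ⟨b, hb⟩
    · exact absurd h (ψ (e a)).2
    · have hb' : ψ (e a) = e b := Subtype.ext hb.symm
      refine ⟨b, hb', ?_⟩
      rw [← hdist, ← hdist, ← hb', (h1 _ (hno ha)).2]
  have hfix : ψ (e r) = e (-r) := by
    obtain ⟨b, hb, hbr⟩ := hmem r hr0.ne'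
    rw [abs_of_pos hr0, sq] at hbr
    rcases eq_or_eq_neg_of_abs_eq (mul_right_cancel₀ hr0.ne' hbr) with rfl | rfl
    · refine absurd ?_ (hφ.2.2.1 (e b).1)
      rw [← h0 _ (hno hr0.ne'), hb]
    · exact hb
  obtain ⟨b, hb, hba⟩ := hmem a ha
  have e1 := h2 _ _ (hno ha) (hno hr0.ne')
  rw [hb, hfix, isometry_dist he, isometry_dist he, hdist, hdist, abs_of_pos hr0] at e1
  have e2 : |b * a| = |r ^ 2| := by rw [abs_mul, hba, abs_of_nonneg (sq_nonneg r)]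
  rw [hb]
  congr 1
  rw [eq_neg_iff_add_eq_zero]
  rcases abs_eq_abs.1 e2 with e3 | e3
  · exfalso
    have e4 : |(b - -r) * a| = |r * (a - r)| := by
      rw [abs_mul, abs_mul, abs_of_pos hr0]
      apply mul_right_cancel₀ hr0.ne'
      linear_combination e1
    have e5 : (b - -r) * a = r * (a + r) := by linear_combination e3
    rw [e5, abs_mul, abs_mul, mul_right_inj' (abs_pos.2 hr0.ne').ne'] at e4
    rcases abs_eq_abs.1 e4 with e6 | e6
    · linarith
    · exact ha (by linarith)
  · field_simp
    linarith

end Inversions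

section Fibers

open Filter Topology Set

variable {X : Type*} {S : MobiusStructure X} {d : ExtMetric X} {ω : X} [t : TopologicalSpace X]

theorem isPtolemyLine_range (ht : t = mobiusTop S) [CompactSpace X] (hd : d ∈ S.M)
    {hr : d.rem = some ω} {c : ℝ → AffinePart d ω hr} (hc : Isometry c) :
    IsPtolemyLine S ω (range fun t => (c t).1) := by
  refine ⟨_, isPtolemyCircle_of_isometry ht hd hc, mem_insert _ _, ?_⟩
  rw [insert_sdiff_self_of_notMem]
  rintro ⟨t, h⟩
  exact (c t).2 h

theorem IsPtolemyLine.exists_isometry (ht : t = mobiusTop S) [CompactSpace X]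
    (hI : PropertyI S) (hd : d ∈ S.M) (hr : d.rem = some ω) {l : Set X}
    (hl : IsPtolemyLine S ω l) {x : AffinePart d ω hr} (hx : x.1 ∈ l) :
    ∃ c : ℝ → AffinePart d ω hr, Isometry c ∧ c 0 = x ∧ (range fun t => (c t).1) = l := by
  obtain ⟨σ, hσ, hω, rfl⟩ := hl
  obtain ⟨c, hc, hcσ⟩ := exists_isometry_of_isPtolemyCircle ht hI hd hr hσ hω
  rw [← hcσ] at hx ⊢
  obtain ⟨a, ha⟩ := hx
  refine ⟨fun t => c (a + t), Isometry.shift hc a, ?_, ?_⟩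
  · change c (a + 0) = x
    rw [add_zero]
    exact Subtype.ext ha
  · exact (Equiv.addLeft a).surjective.range_comp fun t => (c t).1

theorem mem_mobiusFiber_iff (ht : t = mobiusTop S) [CompactSpace X] (hd : d ∈ S.M)
    {hr : d.rem = some ω} (x y : AffinePart d ω hr) :
    x.1 ∈ mobiusFiber S d ω y.1 ↔
      ∀ c : ℝ → AffinePart d ω hr, Isometry c → bus c x = bus c y := by
  classical
  constructor
  · rintro ⟨-, h⟩ c hc
    have := h (range fun t => (c t).1)
      (fun x => if hx : x ≠ ω then bus c (⟨x, hx⟩ : AffinePart d ω hr) else 0)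
      ⟨isPtolemyLine_range ht hd hc, fun t => (c t).1, ⟨rfl, fun s t => ?_⟩, 0, fun x hx => ?_⟩
    · rwa [dif_pos x.2, dif_pos y.2] at this
    · rw [← AffinePart.edist_def, edist_dist, isometry_dist hc]
    · have hval : (if hx : x ≠ ω then bus c (⟨x, hx⟩ : AffinePart d ω hr) else 0) + 0 =
          bus c (⟨x, hx⟩ : AffinePart d ω hr) := by rw [dif_pos hx, add_zero]
      exact (tendsto_bus hc (⟨x, hx⟩ : AffinePart d ω hr)).trans (le_of_eq (congrArg 𝓝 hval.symm))
  · refine fun h => ⟨x.2, ?_⟩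
    rintro l b ⟨⟨σ, -, -, rfl⟩, c, ⟨hcr, hcd⟩, C, hC⟩
    have hcω : ∀ s, c s ≠ ω := fun s => (hcr ▸ mem_range_self s : c s ∈ σ \ {ω}).2
    let c' : ℝ → AffinePart d ω hr := fun s => ⟨c s, hcω s⟩
    have hc' : Isometry c' := isometry_of_dist fun s t => by
      rw [AffinePart.dist_def, hcd, ENNReal.toReal_ofReal (abs_nonneg _)]
    have hb : ∀ z : AffinePart d ω hr, b z.1 + C = bus c' z := fun z =>
      tendsto_nhds_unique (hC z.1 z.2) (tendsto_bus hc' z)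
    have := h c' hc'
    rw [← hb, ← hb] at this
    linarith

theorem existsUnique_isPtolemyLine (ht : t = mobiusTop S) [CompactSpace X]
    (hpt : IsPtolemyStructure S) (hE : PropertyE S) (hI : PropertyI S) (hd : d ∈ S.M)
    {hr : d.rem = some ω} (x y : AffinePart d ω hr) (hxy : x.1 ∉ mobiusFiber S d ω y.1) :
    ∃! l : Set X, IsPtolemyLine S ω l ∧ x.1 ∈ l ∧ (l ∩ mobiusFiber S d ω y.1).Nonempty := by
  have hproper := AffinePart.properSpace ht hd hr
  have hP := AffinePart.ptolemyIneq hpt hd hr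
  have hInv := hasInversions ht hE hI hd hr
  have hsep : ∃ c : ℝ → AffinePart d ω hr, Isometry c ∧ bus c y ≠ bus c x := by
    rw [mem_mobiusFiber_iff ht hd] at hxy
    push Not at hxy
    obtain ⟨c, hc, h⟩ := hxy
    exact ⟨c, hc, h.symm⟩
  have hne : ∀ {e : ℝ → AffinePart d ω hr} {a : ℝ}, e 0 = x →
      (e a).1 ∈ mobiusFiber S d ω y.1 → a ≠ 0 := by
    rintro e _ h0 hF rfl
    exact hxy (h0 ▸ hF)
  obtain ⟨e, he, he0, a, hea⟩ := exists_line hP hInv hsep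
  have heF : (e a).1 ∈ mobiusFiber S d ω y.1 := (mem_mobiusFiber_iff ht hd _ _).2 hea
  refine ⟨range fun t => (e t).1, ⟨isPtolemyLine_range ht hd he,
    ⟨0, congrArg Subtype.val he0⟩, _, ⟨a, rfl⟩, heF⟩, ?_⟩
  rintro l ⟨hl, hxl, z, hzl, hzF⟩
  obtain ⟨c, hc, hc0, rfl⟩ := hl.exists_isometry ht hI hd hr hxl
  obtain ⟨b, rfl⟩ := hzl
  have hcb := (mem_mobiusFiber_iff ht hd _ _).1 hzF
  have := range_eq_of_bus_eq hInv hc he (hc0.trans he0.symm) (hne hc0 hzF) (hne he0 heF)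
    fun f hf => (hcb f hf).trans (hea f hf).symm
  have himage := congrArg (fun s => (fun z : AffinePart d ω hr => z.1) '' s) this
  simpa only [← range_comp, Function.comp_def] using himage

end Fibers

/-- property (1_𝕂) of the paper.  Let `X` be a compact Ptolemy space
with properties (E) and (I) and `ω ∈ X`.  For every fiber `F` of the canonical
fibration `π_ω` and every `x ∈ X_ω∖F` there is exactly one Ptolemy line in `X_ω`
containing `x` and intersecting `F`. -/
theorem stmt_11 {X : Type*} (S : MobiusStructure X)
    (hpt : IsPtolemyStructure S) (hcomp : MobiusCompact S)
    (hE : PropertyE S) (hI : PropertyI S)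
    (ω : X) (d : ExtMetric X) (hd : d ∈ S.M) (hrem : d.rem = some ω)
    (F : Set X) (hF : F ∈ mobiusBase S d ω)
    (x : X) (hx : x ≠ ω) (hxF : x ∉ F) :
    ∃! l : Set X, IsPtolemyLine S ω l ∧ x ∈ l ∧ (l ∩ F).Nonempty := by
  obtain ⟨y, hy, rfl⟩ := hF
  let := mobiusTop S
  have : CompactSpace X := hcomp
  exact existsUnique_isPtolemyLine (hr := hrem) rfl hpt hE hI hd ⟨x, hx⟩ ⟨y, hy⟩ hxF

end Mobius
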